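/- arXiv:1809.09134 — 2 statements merged into one kernel-verified Lean document; each statement's English description precedes it below -/
import Mathlib

section
/- Let A and B be separable C*-algebras that are strongly RFD, and let C be a C*-subalgebra that is central in both A and B. Then the full amalgamated free product A *_C B is residually finite dimensional. -/
noncomputable section

/-- A (non-unital) C*-algebra `A` is *residually finite dimensional* (RFD) if its
finite-dimensional representations separate its points: for every nonzero `a ∈ A`
there is a finite-dimensional representation `π` with `π a ≠ 0`. -/
def IsRFD (A : Type) [NonUnitalNormedRing A] [StarRing A] [NormedSpace ℂ A]
    [IsScalarTower ℂ A A] [SMulCommClass ℂ A A] : Prop :=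
  ∀ a : A, a ≠ 0 → ∃ (n : ℕ)
    (π : A →⋆ₙₐ[ℂ] (EuclideanSpace ℂ (Fin n) →L[ℂ] EuclideanSpace ℂ (Fin n))),
    π a ≠ 0

/-- A C*-algebra is *strongly RFD* if all of its quotients are RFD; equivalently,
every surjective *-homomorphic image (which is automatically a C*-algebra) is RFD. -/
def IsStronglyRFD (A : Type) [NonUnitalNormedRing A] [StarRing A] [NormedSpace ℂ A]
    [IsScalarTower ℂ A A] [SMulCommClass ℂ A A] : Prop :=
  ∀ (B : Type) [NonUnitalNormedRing B] [StarRing B] [CStarRing B] [CompleteSpace B]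
    [NormedSpace ℂ B] [IsScalarTower ℂ B B] [SMulCommClass ℂ B B] [StarModule ℂ B],
    ∀ φ : A →⋆ₙₐ[ℂ] B, Function.Surjective φ → IsRFD B

/-- A representation of `A` on a Hilbert space `H` is *irreducible* if it has no
nontrivial closed invariant subspaces. -/
def IsIrreducibleRep {A : Type} [NonUnitalNormedRing A] [StarRing A] [NormedSpace ℂ A]
    [IsScalarTower ℂ A A] [SMulCommClass ℂ A A]
    {H : Type} [NormedAddCommGroup H] [InnerProductSpace ℂ H] [CompleteSpace H]
    (π : A →⋆ₙₐ[ℂ] (H →L[ℂ] H)) : Prop :=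
  ∀ S : Submodule ℂ H, IsClosed (S : Set H) → (∀ a : A, ∀ x ∈ S, π a x ∈ S) →
    S = ⊥ ∨ S = ⊤

/-- A C*-algebra is *FDI* if all of its irreducible representations are finite
dimensional. -/
def IsFDI (A : Type) [NonUnitalNormedRing A] [StarRing A] [NormedSpace ℂ A]
    [IsScalarTower ℂ A A] [SMulCommClass ℂ A A] : Prop :=
  ∀ (H : Type) [NormedAddCommGroup H] [InnerProductSpace ℂ H] [CompleteSpace H],
    ∀ π : A →⋆ₙₐ[ℂ] (H →L[ℂ] H), IsIrreducibleRep π → FiniteDimensional ℂ H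

section Auxiliary

open scoped InnerProductSpace

/-- Every selfadjoint element of the range of a `*`-homomorphism has a preimage of no larger norm. -/
theorem NonUnitalStarAlgHom.exists_norm_le_of_isSelfAdjoint {A B : Type*} [NonUnitalCStarAlgebra A]
    [NonUnitalCStarAlgebra B] (φ : A →⋆ₙₐ[ℂ] B) {a : A} (ha : IsSelfAdjoint a) :
    ∃ a', φ a' = φ a ∧ ‖a'‖ ≤ ‖φ a‖ := by
  set r := ‖φ a‖
  have hr : 0 ≤ r := norm_nonneg _
  let f : ℝ → ℝ := fun x => max (-r) (min x r)
  have hf : Continuous f := by fun_prop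
  have hf0 : f 0 = 0 := by simp [f, hr]
  have hφ : Continuous φ := AddMonoidHomClass.continuous_of_bound φ 1 fun x => by
    simpa using NonUnitalStarAlgHom.norm_apply_le φ x
  refine ⟨cfcₙ f a, ?_, ?_⟩
  · rw [φ.map_cfcₙ f a hf.continuousOn hf0 hφ ha (ha.map φ)]
    conv_rhs => rw [← cfcₙ_id ℝ (φ a) (ha := ha.map φ)]
    refine cfcₙ_congr fun x hx => ?_
    have hx' : ‖x‖ ≤ r := by
      have := NonUnitalIsometricContinuousFunctionalCalculus.norm_quasispectrum_le (φ a) hx (ha.map φ)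
      exact this
    rw [Real.norm_eq_abs, abs_le] at hx'
    simp [f, hx'.1, hx'.2]
  · refine norm_cfcₙ_le fun x _ => ?_
    simp only [f, Real.norm_eq_abs, abs_le]
    exact ⟨le_max_left _ _, max_le (by linarith) (min_le_right _ _)⟩

open scoped ComplexStarModule in
/-- The range of a `*`-homomorphism between C⋆-algebras is closed. -/
theorem NonUnitalStarAlgHom.isClosed_range {A B : Type*} [NonUnitalCStarAlgebra A]
    [NonUnitalCStarAlgebra B] (φ : A →⋆ₙₐ[ℂ] B) : IsClosed (Set.range φ) := by
  let f : NormedAddGroupHom A B :=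
    (φ : A →+ B).mkNormedAddGroupHom 1 fun a => by
      simpa using NonUnitalStarAlgHom.norm_apply_le φ a
  have key : f.SurjectiveOnWith f.range 2 := by
    rintro _ ⟨a, rfl⟩
    obtain ⟨b, hb, hb'⟩ := φ.exists_norm_le_of_isSelfAdjoint (ℜ a).2
    obtain ⟨c, hc, hc'⟩ := φ.exists_norm_le_of_isSelfAdjoint (ℑ a).2
    have hre : φ (ℜ a) = ℜ (φ a) := by
      simp [realPart_apply_coe, ← Complex.coe_smul, map_star]
    have him : φ (ℑ a) = ℑ (φ a) := by
      simp [imaginaryPart_apply_coe, ← Complex.coe_smul, map_star]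
    refine ⟨b + Complex.I • c, ?_, ?_⟩
    · change φ _ = φ a
      rw [map_add, map_smul, hb, hc, ← map_smul, ← map_add, realPart_add_I_smul_imaginaryPart]
    · have h1 : ‖(ℜ (φ a) : B)‖ ≤ ‖φ a‖ := realPart.norm_le (φ a)
      have h2 : ‖(ℑ (φ a) : B)‖ ≤ ‖φ a‖ := imaginaryPart.norm_le (φ a)
      calc ‖b + Complex.I • c‖ ≤ ‖b‖ + ‖Complex.I • c‖ := norm_add_le _ _
        _ = ‖b‖ + ‖c‖ := by rw [norm_smul]; simp
        _ ≤ ‖φ a‖ + ‖φ a‖ := by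
            rw [hre] at hb'; rw [him] at hc'; exact add_le_add (hb'.trans h1) (hc'.trans h2)
        _ = 2 * ‖f a‖ := (two_mul _).symm
  have := controlled_closure_of_complete two_pos one_pos key
  refine isClosed_of_closure_subset fun y hy => ?_
  obtain ⟨a, ha, -⟩ := this y hy
  exact ⟨a, ha⟩

section States

open scoped ComplexOrder ComplexStarModule

/-- The states of a unital C⋆-algebra, as a subset of the space of all functions. -/
def stateSet (D : Type*) [CStarAlgebra D] : Set (D → ℂ) :=
  {f | (∀ x y, f (x + y) = f x + f y) ∧ (∀ (c : ℂ) x, f (c • x) = c * f x) ∧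
    (∀ x, 0 ≤ f (star x * x)) ∧ f 1 = 1}

variable {D : Type*} [CStarAlgebra D] [PartialOrder D] [StarOrderedRing D]

/-- A positive linear functional, from its values and positivity on the elements `star x * x`. -/
def positiveFunctional (f : D → ℂ) (hadd : ∀ x y, f (x + y) = f x + f y)
    (hsmul : ∀ (c : ℂ) x, f (c • x) = c * f x) (hpos : ∀ x, 0 ≤ f (star x * x)) : D →ₚ[ℂ] ℂ :=
  PositiveLinearMap.mk₀ { toFun := f, map_add' := hadd, map_smul' := hsmul } fun x hx => by
    obtain ⟨y, rfl⟩ := CStarAlgebra.nonneg_iff_eq_star_mul_self.mp hx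
    exact hpos y

@[simp]
theorem positiveFunctional_apply (f : D → ℂ) (hadd : ∀ x y, f (x + y) = f x + f y)
    (hsmul : ∀ (c : ℂ) x, f (c • x) = c * f x) (hpos : ∀ x, 0 ≤ f (star x * x)) (x : D) :
    positiveFunctional f hadd hsmul hpos x = f x := rfl

theorem PositiveLinearMap.norm_apply_sq_le (f : D →ₚ[ℂ] ℂ) (x : D) :
    ‖f x‖ ^ 2 ≤ (f 1).re * (f (star x * x)).re := by
  have h := norm_inner_le_norm (𝕜 := ℂ) (f.toPreGNS 1) (f.toPreGNS x)
  have h1 : (0 : ℝ) ≤ (f 1).re := by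
    have := f.map_nonneg (zero_le_one (α := D)); exact this.1
  have h2 : (0 : ℝ) ≤ (f (star x * x)).re := (f.map_nonneg (star_mul_self_nonneg x)).1
  rw [f.preGNS_inner_def, f.preGNS_norm_def, f.preGNS_norm_def] at h
  simp only [f.ofPreGNS_toPreGNS, star_one, one_mul] at h
  calc ‖f x‖ ^ 2 ≤ (√(f 1).re * √(f (star x * x)).re) ^ 2 := by gcongr
    _ = _ := by rw [mul_pow, Real.sq_sqrt h1, Real.sq_sqrt h2]

theorem PositiveLinearMap.norm_apply_le_mul (f : D →ₚ[ℂ] ℂ) (x : D) :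
    ‖f x‖ ≤ (f 1).re * ‖x‖ := by
  have h1 : (0 : ℝ) ≤ (f 1).re := by
    have := f.map_nonneg (zero_le_one (α := D)); exact this.1
  have h2 : (f (star x * x)).re ≤ ‖x‖ ^ 2 * (f 1).re := by
    have h3 : star x * x ≤ ((‖x‖ ^ 2 : ℝ) : ℂ) • (1 : D) := by
      have := IsSelfAdjoint.le_algebraMap_norm_self (IsSelfAdjoint.star_mul_self x)
      rwa [CStarRing.norm_star_mul_self, ← sq, Algebra.algebraMap_eq_smul_one,
        ← Complex.coe_smul] at this
    have h4 := (OrderHomClass.mono f h3).1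
    rw [map_smul, smul_eq_mul, Complex.re_ofReal_mul] at h4
    exact h4
  refine abs_le_of_sq_le_sq' ?_ (by positivity) |>.2
  calc ‖f x‖ ^ 2 ≤ (f 1).re * (f (star x * x)).re := f.norm_apply_sq_le x
    _ ≤ (f 1).re * (‖x‖ ^ 2 * (f 1).re) := by gcongr
    _ = _ := by ring

theorem norm_apply_le_of_mem_stateSet {f : D → ℂ} (hf : f ∈ stateSet D) (x : D) : ‖f x‖ ≤ ‖x‖ := by
  have := (positiveFunctional f hf.1 hf.2.1 hf.2.2.1).norm_apply_le_mul x
  simpa [hf.2.2.2] using this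

theorem isCompact_stateSet : IsCompact (stateSet D) := by
  have hsub : stateSet D ⊆ Set.univ.pi fun x : D => Metric.closedBall (0 : ℂ) ‖x‖ := by
    intro f hf x _
    simpa using norm_apply_le_of_mem_stateSet hf x
  refine (isCompact_univ_pi fun x : D => isCompact_closedBall (0 : ℂ) ‖x‖).of_isClosed_subset ?_ hsub
  simp only [stateSet, Set.ofPred_and, Set.ofPred_forall]
  refine IsClosed.inter ?_ (IsClosed.inter ?_ (IsClosed.inter ?_ ?_))
  · exact isClosed_iInter fun x => isClosed_iInter fun y => isClosed_eq (by fun_prop) (by fun_prop)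
  · exact isClosed_iInter fun x => isClosed_iInter fun y => isClosed_eq (by fun_prop) (by fun_prop)
  · exact isClosed_iInter fun x => isClosed_le (by fun_prop) (by fun_prop)
  · exact isClosed_eq (by fun_prop) (by fun_prop)

theorem exists_mem_stateSet_re_pos {d : D} (hd : d ≠ 0) :
    ∃ f ∈ stateSet D, 0 < (f (star d * d)).re := by
  have hnot : -(star d * d) ∉ ProperCone.positive ℝ D := by
    intro h
    have h1 : 0 ≤ -(star d * d) := h
    have h2 : star d * d = 0 := le_antisymm (neg_nonneg.mp h1) (star_mul_self_nonneg d)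
    exact hd (CStarRing.star_mul_self_eq_zero_iff d |>.mp h2)
  obtain ⟨g, hg, hgd⟩ := (ProperCone.positive ℝ D).hyperplane_separation_point hnot
  have hg0 : ∀ x : D, 0 ≤ g (star x * x) := fun x => hg _ (star_mul_self_nonneg x)
  let F : D → ℂ := fun x => g (ℜ x) + Complex.I * g (ℑ x)
  have Fadd : ∀ x y, F (x + y) = F x + F y := fun x y => by
    simp only [F, map_add, AddSubgroup.coe_add, Complex.ofReal_add]; ring
  have Fsmul : ∀ (c : ℂ) x, F (c • x) = c * F x := fun c x => by
    simp only [F, realPart_smul, imaginaryPart_smul]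
    apply Complex.ext <;> simp
  have Fsa : ∀ x : D, IsSelfAdjoint x → F x = g x := fun x hx => by
    simp [F, hx.coe_realPart, hx.imaginaryPart]
  have Fpos : ∀ x, 0 ≤ F (star x * x) := fun x => by
    rw [Fsa _ (.star_mul_self x)]; exact_mod_cast hg0 x
  have Fd : 0 < (F (star d * d)).re := by
    rw [Fsa _ (.star_mul_self d)]
    rw [map_neg] at hgd; simpa using hgd
  have F1 : 0 < g 1 := by
    have := (positiveFunctional F Fadd Fsmul Fpos).norm_apply_le_mul (star d * d)
    simp only [positiveFunctional_apply] at this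
    rw [Fsa 1 (.one D), Complex.ofReal_re] at this
    by_contra hneg
    have h5 : (F (star d * d)).re ≤ ‖F (star d * d)‖ := Complex.re_le_norm _
    nlinarith [norm_nonneg (star d * d)]
  refine ⟨fun x => ((g 1)⁻¹ : ℝ) * F x, ⟨?_, ?_, ?_, ?_⟩, ?_⟩
  · intro x y; beta_reduce; rw [Fadd, mul_add]
  · intro c x; beta_reduce; rw [Fsmul]; ring
  · intro x
    refine mul_nonneg ?_ (Fpos x)
    exact_mod_cast (inv_pos.mpr F1).le
  · beta_reduce
    rw [Fsa 1 (.one D), ← Complex.ofReal_mul, inv_mul_cancel₀ F1.ne']; simp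
  · rw [Complex.re_ofReal_mul]; positivity

/-- A pure state is multiplicative against central selfadjoint strict contractions. -/
theorem apply_mul_of_mem_extremePoints_of_isSelfAdjoint {f : D → ℂ}
    (hf : f ∈ (stateSet D).extremePoints ℝ) {z : D}
    (hz : IsSelfAdjoint z) (hzc : ∀ x, z * x = x * z) (hz1 : ‖z‖ < 1) (x : D) :
    f (z * x) = f z * f x := by
  obtain ⟨hfQ, hext⟩ := mem_extremePoints.mp hf
  have hf' := hfQ
  obtain ⟨hadd, hsmul, hpos, hone⟩ := hf'
  let φ := positiveFunctional f hadd hsmul hpos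
  have hφ : ∀ x, φ x = f x := fun _ => rfl
  have hmono : ∀ {y : D}, 0 ≤ y → 0 ≤ f y := fun hy => φ.map_nonneg hy
  have hle1 : z ≤ ‖z‖ • (1 : D) := by
    simpa [Algebra.algebraMap_eq_smul_one] using hz.le_algebraMap_norm_self
  have hle2 : -(‖z‖ • (1 : D)) ≤ z := by
    simpa [Algebra.algebraMap_eq_smul_one] using hz.neg_algebraMap_norm_le_self
  have hle3 : ‖z‖ • (1 : D) ≤ (1 : D) := by
    have : 0 ≤ (1 - ‖z‖) • (1 : D) := smul_nonneg (by linarith) zero_le_one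
    rw [sub_smul, one_smul] at this
    exact sub_nonneg.mp this
  have hfz : ((f z).re : ℂ) = f z := by
    have h : star (f z) = f z := by
      have := map_star φ z
      rw [hz.star_eq] at this
      exact this.symm
    exact Complex.conj_eq_iff_re.mp h
  have hfzn : |(f z).re| < 1 :=
    (Complex.abs_re_le_norm _).trans_lt ((norm_apply_le_of_mem_stateSet hfQ z).trans_lt hz1)
  rw [abs_lt] at hfzn
  have hmem : ∀ w : D, 0 ≤ w → (∀ x, w * x = x * w) → 0 < (f w).re → ((f w).re : ℂ) = f w →
      (fun x => ((f w).re⁻¹ : ℝ) * f (w * x)) ∈ stateSet D := by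
    intro w hw hwc hw0 hwre
    refine ⟨fun x y => ?_, fun c x => ?_, fun x => ?_, ?_⟩
    · beta_reduce; rw [mul_add, hadd]; ring
    · beta_reduce; rw [mul_smul_comm, hsmul]; ring
    · refine mul_nonneg (by exact_mod_cast (inv_pos.mpr hw0).le) (hmono ?_)
      rw [← mul_assoc, hwc]
      exact star_left_conjugate_nonneg hw x
    · beta_reduce; rw [mul_one]; nth_rw 2 [← hwre]
      rw [← Complex.ofReal_mul, inv_mul_cancel₀ hw0.ne']; simp
  have hneg : f (-z) = -f z := by simpa using hsmul (-1) z
  have e1 : f (1 + z) = 1 + f z := by rw [hadd, hone]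
  have e2 : f (1 - z) = 1 - f z := by rw [sub_eq_add_neg, hadd, hone, hneg]; ring
  have m1 := hmem (1 + z) (by
      have := hle2.trans' (neg_le_neg hle3); simpa using add_le_add_right this 1)
    (fun x => by rw [add_mul, mul_add, hzc, one_mul, mul_one]) (by rw [e1]; simp; linarith)
    (by rw [e1]; simp [hfz])
  have m2 := hmem (1 - z) (sub_nonneg.mpr (hle1.trans hle3))
    (fun x => by rw [sub_mul, mul_sub, hzc, one_mul, mul_one]) (by rw [e2]; simp; linarith)
    (by rw [e2]; simp [hfz])
  have hre1 : (f (1 + z)).re = 1 + (f z).re := by rw [e1]; simp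
  have hre2 : (f (1 - z)).re = 1 - (f z).re := by rw [e2]; simp
  have hseg : f ∈ openSegment ℝ (fun x => (((f (1 + z)).re⁻¹ : ℝ) : ℂ) * f ((1 + z) * x))
      (fun x => (((f (1 - z)).re⁻¹ : ℝ) : ℂ) * f ((1 - z) * x)) := by
    refine ⟨(1 + (f z).re) / 2, (1 - (f z).re) / 2, by linarith, by linarith, by ring, ?_⟩
    funext x
    have h1 : (1 + ((f z).re : ℂ)) ≠ 0 := by
      rw [← Complex.ofReal_one, ← Complex.ofReal_add, Complex.ofReal_ne_zero]; linarith
    have h2 : (1 - ((f z).re : ℂ)) ≠ 0 := by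
      rw [← Complex.ofReal_one, ← Complex.ofReal_sub, Complex.ofReal_ne_zero]; linarith
    have hx1 : f ((1 + z) * x) = f x + f (z * x) := by rw [add_mul, hadd, one_mul]
    have hx2 : f ((1 - z) * x) = f x - f (z * x) := by
      have : f (-(z * x)) = - f (z * x) := by simpa using hsmul (-1) (z * x)
      rw [sub_mul, one_mul, sub_eq_add_neg, hadd, this]; ring
    simp only [Pi.add_apply, Pi.smul_apply, hre1, hre2, hx1, hx2, Complex.real_smul]
    push_cast
    field_simp
    ring
  have h := congrFun (hext _ m1 _ m2 hseg).1 x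
  rw [hre1, add_mul, one_mul, hadd] at h
  have h1 : (1 + ((f z).re : ℂ)) ≠ 0 := by
    rw [← Complex.ofReal_one, ← Complex.ofReal_add, Complex.ofReal_ne_zero]; linarith
  push_cast at h
  field_simp at h
  rw [hfz] at h
  linear_combination h

/-- A pure state is multiplicative against central elements. -/
theorem apply_mul_of_mem_extremePoints {f : D → ℂ} (hf : f ∈ (stateSet D).extremePoints ℝ) {z : D}
    (hzc : ∀ x, z * x = x * z) (x : D) : f (z * x) = f z * f x := by
  obtain ⟨hadd, hsmul, -, -⟩ := (mem_extremePoints.mp hf).1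
  have hsa : ∀ y : D, IsSelfAdjoint y → (∀ x, y * x = x * y) → f (y * x) = f y * f x := by
    intro y hy hyc
    have hpos : 0 < ‖y‖ + 1 := by positivity
    have hs : IsSelfAdjoint (((‖y‖ + 1 : ℝ) : ℂ)⁻¹ • y) := by
      rw [← Complex.ofReal_inv, Complex.coe_smul]
      exact IsSelfAdjoint.smul (IsSelfAdjoint.all _) hy
    have := apply_mul_of_mem_extremePoints_of_isSelfAdjoint hf hs
      (fun x => by rw [smul_mul_assoc, mul_smul_comm, hyc]) (by
        rw [norm_smul, norm_inv, Complex.norm_real, Real.norm_of_nonneg hpos.le,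
          inv_mul_lt_one₀ hpos]
        linarith) x
    rw [smul_mul_assoc, hsmul, hsmul, mul_assoc] at this
    refine mul_left_cancel₀ (inv_ne_zero ?_) this
    exact Complex.ofReal_ne_zero.mpr hpos.ne'
  have hzs : ∀ x, star z * x = x * star z := fun x => by
    have := congrArg star (hzc (star x))
    simpa using this.symm
  have hre : ∀ x, (ℜ z : D) * x = x * ℜ z := fun x => by
    rw [realPart_apply_coe, smul_mul_assoc, mul_smul_comm, add_mul, mul_add, hzc, hzs]
  have him : ∀ x, (ℑ z : D) * x = x * ℑ z := fun x => by
    rw [imaginaryPart_apply_coe]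
    simp only [smul_mul_assoc, mul_smul_comm, sub_mul, mul_sub, hzc, hzs]
  conv_lhs => rw [← realPart_add_I_smul_imaginaryPart z]
  conv_rhs => rw [← realPart_add_I_smul_imaginaryPart z]
  rw [add_mul, hadd, hadd, smul_mul_assoc, hsmul, hsmul, hsa _ (ℜ z).2 hre, hsa _ (ℑ z).2 him]
  ring

/-- Every nonzero element is detected by a pure state. -/
theorem exists_mem_extremePoints_re_pos {d : D} (hd : d ≠ 0) :
    ∃ f ∈ (stateSet D).extremePoints ℝ, 0 < (f (star d * d)).re := by
  obtain ⟨f, hf, hfd⟩ := exists_mem_stateSet_re_pos hd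
  let ℓ : StrongDual ℝ (D → ℂ) :=
    Complex.reCLM.comp (ContinuousLinearMap.proj (R := ℝ) (star d * d))
  have hexp : IsExposed ℝ (stateSet D) (ℓ.toExposed (stateSet D)) :=
    ContinuousLinearMap.toExposed.isExposed
  obtain ⟨g, hg, hmax⟩ := isCompact_stateSet.exists_isMaxOn ⟨f, hf⟩ ℓ.continuous.continuousOn
  obtain ⟨e, he⟩ := (hexp.isCompact isCompact_stateSet).extremePoints_nonempty
    ⟨g, hg, fun y hy => hmax hy⟩
  refine ⟨e, hexp.isExtreme.extremePoints_subset_extremePoints he, ?_⟩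
  exact hfd.trans_le ((extremePoints_subset he).2 f hf)

/-- If `φ` vanishes on the ideal generated by a central element `w`, so does its GNS
representation on `w`. -/
theorem PositiveLinearMap.gnsStarAlgHom_eq_zero (φ : D →ₚ[ℂ] ℂ) {w : D}
    (hw : ∀ x, w * x = x * w) (hφ : ∀ x, φ (w * x) = 0) : φ.gnsStarAlgHom w = 0 := by
  ext b
  induction b using UniformSpace.Completion.induction_on with
  | hp => exact isClosed_eq (φ.gnsStarAlgHom w).continuous continuous_const
  | ih b =>
    obtain ⟨b, rfl⟩ := φ.toPreGNS.surjective b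
    have hwb : φ (star (w * b) * (w * b)) = 0 := by
      rw [← mul_assoc, ← hw, mul_assoc, hφ]
    change _ = (0 : φ.GNS)
    rw [← norm_eq_zero]
    have h2 : ‖φ.toPreGNS (w * b)‖ = 0 := by
      rw [φ.preGNS_norm_def, φ.ofPreGNS_toPreGNS, hwb]
      simp
    simpa using h2

end States

open scoped ComplexOrder in
/-- The points of a unital C⋆-algebra are separated by unital representations in which the center
acts by scalars. -/
theorem exists_starAlgHom_center_scalar {D : Type} [CStarAlgebra D] {d : D} (hd : d ≠ 0) :
    ∃ (H : Type) (_ : NormedAddCommGroup H) (_ : InnerProductSpace ℂ H) (_ : CompleteSpace H)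
      (π : D →⋆ₐ[ℂ] (H →L[ℂ] H)), π d ≠ 0 ∧
      ∀ z : D, (∀ x, z * x = x * z) → ∃ c : ℂ, π z = c • 1 := by
  let _ := CStarAlgebra.spectralOrder D
  have _ := CStarAlgebra.spectralOrderedRing D
  obtain ⟨f, hf, hfd⟩ := exists_mem_extremePoints_re_pos hd
  obtain ⟨hadd, hsmul, hpos, hone⟩ := (mem_extremePoints.mp hf).1
  obtain ⟨φ, hφ⟩ : ∃ φ : D →ₚ[ℂ] ℂ, ∀ x, φ x = f x :=
    ⟨positiveFunctional f hadd hsmul hpos, fun _ => rfl⟩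
  refine ⟨φ.GNS, inferInstance, inferInstance, inferInstance, φ.gnsStarAlgHom, ?_, ?_⟩
  · intro h
    have h1 : φ.gnsStarAlgHom d (φ.toPreGNS 1 : φ.GNS) = (φ.toPreGNS d : φ.GNS) := by
      simp
    rw [h] at h1
    change (0 : φ.GNS) = _ at h1
    have h2 : ‖φ.toPreGNS d‖ = 0 := by
      rw [← UniformSpace.Completion.norm_coe, ← h1, norm_zero]
    rw [φ.preGNS_norm_def, Real.sqrt_eq_zero', φ.ofPreGNS_toPreGNS, hφ] at h2
    exact absurd hfd (not_lt.mpr h2)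
  · intro z hz
    refine ⟨f z, ?_⟩
    have h := φ.gnsStarAlgHom_eq_zero (w := z - f z • 1)
      (fun x => by simp [sub_mul, mul_sub, hz]) (fun x => by
        rw [sub_mul, map_sub, smul_mul_assoc, one_mul, map_smul, hφ, hφ,
          apply_mul_of_mem_extremePoints hf hz, smul_eq_mul, sub_self])
    rwa [map_sub, map_smul, map_one, sub_eq_zero] at h

section MatrixAction

variable {𝒜 : Type*} [CStarAlgebra 𝒜] {K : Type*} [NormedAddCommGroup K] [InnerProductSpace ℂ K]
  [CompleteSpace K] {n : Type*} [Fintype n]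

/-- The action of a matrix over `𝒜` on tuples of vectors, through a representation `σ` of `𝒜`. -/
def matrixAct (σ : 𝒜 →⋆ₐ[ℂ] (K →L[ℂ] K)) (m : CStarMatrix n n 𝒜) (v : n → K) : n → K :=
  fun i => ∑ j, σ (m i j) (v j)

/-- The quadratic form of a matrix over `𝒜` on tuples of vectors. -/
def matrixForm (σ : 𝒜 →⋆ₐ[ℂ] (K →L[ℂ] K)) (m : CStarMatrix n n 𝒜) (v : n → K) : ℂ :=
  ∑ i, ⟪v i, matrixAct σ m v i⟫_ℂ

theorem matrixAct_mul (σ : 𝒜 →⋆ₐ[ℂ] (K →L[ℂ] K)) (m m' : CStarMatrix n n 𝒜) (v : n → K) :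
    matrixAct σ (m * m') v = matrixAct σ m (matrixAct σ m' v) := by
  funext i
  simp only [matrixAct, CStarMatrix.mul_apply, map_sum, map_mul, sum_apply,
    mul_apply_eq_comp]
  exact Finset.sum_comm

theorem sum_inner_matrixAct_star (σ : 𝒜 →⋆ₐ[ℂ] (K →L[ℂ] K)) (m : CStarMatrix n n 𝒜)
    (u v : n → K) :
    ∑ i, ⟪u i, matrixAct σ (star m) v i⟫_ℂ = ∑ i, ⟪matrixAct σ m u i, v i⟫_ℂ := by
  simp only [matrixAct, inner_sum, sum_inner, CStarMatrix.star_apply, map_star,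
    ContinuousLinearMap.star_eq_adjoint, ContinuousLinearMap.adjoint_inner_right]
  exact Finset.sum_comm

theorem matrixForm_star_mul (σ : 𝒜 →⋆ₐ[ℂ] (K →L[ℂ] K)) (m m' : CStarMatrix n n 𝒜)
    (v : n → K) :
    matrixForm σ (star m * m') v = ∑ i, ⟪matrixAct σ m v i, matrixAct σ m' v i⟫_ℂ := by
  rw [matrixForm, matrixAct_mul, sum_inner_matrixAct_star]

theorem matrixForm_star_mul_self (σ : 𝒜 →⋆ₐ[ℂ] (K →L[ℂ] K)) (m : CStarMatrix n n 𝒜)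
    (v : n → K) :
    matrixForm σ (star m * m) v = ((∑ i, ‖matrixAct σ m v i‖ ^ 2 : ℝ) : ℂ) := by
  rw [matrixForm_star_mul]
  push_cast
  exact Finset.sum_congr rfl fun i _ => inner_self_eq_norm_sq_to_K _

theorem matrixForm_add (σ : 𝒜 →⋆ₐ[ℂ] (K →L[ℂ] K)) (m m' : CStarMatrix n n 𝒜) (v : n → K) :
    matrixForm σ (m + m') v = matrixForm σ m v + matrixForm σ m' v := by
  simp [matrixForm, matrixAct, Finset.sum_add_distrib]

theorem matrixForm_neg (σ : 𝒜 →⋆ₐ[ℂ] (K →L[ℂ] K)) (m : CStarMatrix n n 𝒜) (v : n → K) :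
    matrixForm σ (-m) v = -matrixForm σ m v := by
  simp [matrixForm, matrixAct, inner_sum]

theorem re_matrixForm_star (σ : 𝒜 →⋆ₐ[ℂ] (K →L[ℂ] K)) (m : CStarMatrix n n 𝒜) (v : n → K) :
    (matrixForm σ (star m) v).re = (matrixForm σ m v).re := by
  rw [matrixForm, sum_inner_matrixAct_star, matrixForm, Complex.re_sum, Complex.re_sum]
  exact Finset.sum_congr rfl fun i _ => inner_re_symm (𝕜 := ℂ) _ _

theorem matrixAct_eq_zero (σ : 𝒜 →⋆ₐ[ℂ] (K →L[ℂ] K)) {m : CStarMatrix n n 𝒜}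
    (h : ∀ i j, σ (m i j) = 0) (v : n → K) : matrixAct σ m v = 0 := by
  funext i
  simp [matrixAct, h]

theorem apply_eq_zero_of_matrixAct_eq_zero (σ : 𝒜 →⋆ₐ[ℂ] (K →L[ℂ] K)) {m : CStarMatrix n n 𝒜}
    (h : ∀ v : n → K, matrixAct σ m v = 0) (i j : n) : σ (m i j) = 0 := by
  classical
  ext x
  have := congrFun (h (Pi.single j x)) i
  simp only [matrixAct, Pi.zero_apply] at this
  rw [Finset.sum_eq_single j (fun k _ hk => by simp [Pi.single_eq_of_ne hk]) (by simp)] at this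
  simpa using this

end MatrixAction

/-- A unital finite-dimensional representation of a C⋆-algebra. -/
structure FinDimRep (𝒜 : Type*) [CStarAlgebra 𝒜] where
  /-- The space of the representation. -/
  K : Type
  [instNormed : NormedAddCommGroup K]
  [instInner : InnerProductSpace ℂ K]
  [instFinite : FiniteDimensional ℂ K]
  [instComplete : CompleteSpace K]
  /-- The representation. -/
  σ : 𝒜 →⋆ₐ[ℂ] (K →L[ℂ] K)

attribute [instance] FinDimRep.instNormed FinDimRep.instInner FinDimRep.instFinite FinDimRep.instComplete

section Positivity

variable {𝒜 : Type*} [CStarAlgebra 𝒜] {H : Type*} [NormedAddCommGroup H] [InnerProductSpace ℂ H]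
  [CompleteSpace H] {n : Type*} [Fintype n]

/-- `R` is *subordinate* to `π` if it factors through the image of `π`. -/
def FinDimRep.Subordinate (R : FinDimRep 𝒜) (π : 𝒜 →⋆ₐ[ℂ] (H →L[ℂ] H)) : Prop :=
  ∀ a, π a = 0 → R.σ a = 0

/-- The image of `π` is residually finite dimensional. -/
def IsRFDImage (π : 𝒜 →⋆ₐ[ℂ] (H →L[ℂ] H)) : Prop :=
  ∀ a, π a ≠ 0 → ∃ R : FinDimRep 𝒜, R.Subordinate π ∧ R.σ a ≠ 0

/-- A selfadjoint element is a difference of positive elements with zero product. -/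
theorem IsSelfAdjoint.exists_orthogonal_decomposition {M : Type*} [NonUnitalCStarAlgebra M] {h : M}
    (hh : IsSelfAdjoint h) :
    ∃ a s : M, h = star a * a - star s * s ∧ star a * a * (star s * s) = 0 := by
  let _ := CStarAlgebra.spectralOrder M
  have _ := CStarAlgebra.spectralOrderedRing M
  obtain ⟨a, ha⟩ := CStarAlgebra.nonneg_iff_eq_star_mul_self.mp (CFC.posPart_nonneg h)
  obtain ⟨s, hs⟩ := CStarAlgebra.nonneg_iff_eq_star_mul_self.mp (CFC.negPart_nonneg h)
  exact ⟨a, s, by rw [← ha, ← hs, CFC.posPart_sub_negPart h hh],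
    by rw [← ha, ← hs, CFC.posPart_mul_negPart]⟩

theorem re_matrixForm_nonneg {π : 𝒜 →⋆ₐ[ℂ] (H →L[ℂ] H)} (hπ : IsRFDImage π)
    (m : CStarMatrix n n 𝒜)
    (hm : ∀ R : FinDimRep 𝒜, R.Subordinate π → ∀ v : n → R.K, 0 ≤ (matrixForm R.σ m v).re)
    (e : n → H) : 0 ≤ (matrixForm π m e).re := by
  have of_zero : ∀ x : CStarMatrix n n 𝒜,
      (∀ R : FinDimRep 𝒜, R.Subordinate π → ∀ v : n → R.K, matrixAct R.σ x v = 0) →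
      ∀ i j, π (x i j) = 0 := by
    intro x hx i j
    by_contra hne
    obtain ⟨R, hR, hRne⟩ := hπ _ hne
    exact hRne (apply_eq_zero_of_matrixAct_eq_zero R.σ (hx R hR) i j)
  set h := m + star m with hh
  let _ := CStarAlgebra.spectralOrder 𝒜
  have _ := CStarAlgebra.spectralOrderedRing 𝒜
  obtain ⟨a, s, hd, ho⟩ :=
    IsSelfAdjoint.exists_orthogonal_decomposition (IsSelfAdjoint.add_star_self m)
  set p := star s * s with hp
  have hps : star p = p := (IsSelfAdjoint.star_mul_self s).star_eq
  have hsp : ∀ i j, π ((s * p) i j) = 0 := by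
    refine of_zero _ fun R hR v => ?_
    have h1 := hm R hR (matrixAct R.σ p v)
    have h2 : matrixForm R.σ h (matrixAct R.σ p v) = -matrixForm R.σ (star (s * p) * (s * p)) v := by
      have e1 : star p * (h * p) = -(star (s * p) * (s * p)) := by
        rw [star_mul s p, hps, hh, hd, sub_mul, ho, zero_sub, mul_neg, mul_assoc p (star s),
          ← mul_assoc (star s) s, ← hp]
      rw [← matrixForm_neg, ← e1, matrixForm_star_mul, matrixAct_mul _ h p, matrixForm]
    rw [matrixForm_star_mul_self] at h2
    have h3 := congrArg Complex.re h2
    rw [hh, matrixForm_add, Complex.add_re, re_matrixForm_star, Complex.neg_re,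
      Complex.ofReal_re] at h3
    have h4 : ∑ i, ‖matrixAct R.σ (s * p) v i‖ ^ 2 = 0 :=
      le_antisymm (by linarith) (by positivity)
    funext i
    simpa using (Finset.sum_eq_zero_iff_of_nonneg (fun i _ => by positivity)).mp h4 i
      (Finset.mem_univ i)
  have hpe : matrixAct π p e = 0 := by
    have h1 : matrixAct π (p * p) e = 0 := by
      rw [hp, mul_assoc, matrixAct_mul, ← hp, matrixAct_eq_zero π hsp]
      funext i
      simp [matrixAct]
    have h2 := matrixForm_star_mul_self π p e
    rw [hps, matrixForm, h1] at h2
    have h4 : ∑ i, ‖matrixAct π p e i‖ ^ 2 = 0 := by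
      have h3 := congrArg Complex.re h2
      rw [Complex.ofReal_re] at h3
      simpa using h3.symm
    funext i
    simpa using (Finset.sum_eq_zero_iff_of_nonneg (fun i _ => by positivity)).mp h4 i
      (Finset.mem_univ i)
  have h5 : matrixForm π h e = ((∑ i, ‖matrixAct π a e i‖ ^ 2 : ℝ) : ℂ) := by
    rw [hh, hd, sub_eq_add_neg, matrixForm_add, matrixForm_neg, matrixForm_star_mul_self,
      matrixForm, hpe]
    simp
  have h6 := congrArg Complex.re h5
  rw [hh, matrixForm_add, Complex.add_re, re_matrixForm_star, Complex.ofReal_re] at h6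
  have : 0 ≤ ∑ i, ‖matrixAct π a e i‖ ^ 2 := by positivity
  linarith

end Positivity

section DirectSum

variable {𝒜 : Type*} [CStarAlgebra 𝒜] {ι : Type} [Fintype ι]

/-- The direct sum of finitely many finite-dimensional representations. -/
def FinDimRep.directSum (R : ι → FinDimRep 𝒜) : FinDimRep 𝒜 where
  K := PiLp 2 fun i => (R i).K
  σ :=
    { toFun a := LinearMap.toContinuousLinearMap
        { toFun v := WithLp.toLp 2 fun i => (R i).σ a (v i)
          map_add' v w := by ext i; simp
          map_smul' c v := by ext i; simp }
      map_one' := by ext v i; simp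
      map_mul' a b := by ext v i; simp
      map_zero' := by ext v i; simp
      map_add' a b := by ext v i; simp
      commutes' c := by ext v i; simp [Algebra.algebraMap_eq_smul_one]
      map_star' a := by
        rw [ContinuousLinearMap.star_eq_adjoint, ContinuousLinearMap.eq_adjoint_iff]
        intro v w
        simp [PiLp.inner_apply, map_star, ContinuousLinearMap.star_eq_adjoint,
          ContinuousLinearMap.adjoint_inner_left] }

theorem FinDimRep.directSum_apply (R : ι → FinDimRep 𝒜) (a : 𝒜) (v : PiLp 2 fun i => (R i).K) :
    (directSum R).σ a v = WithLp.toLp 2 fun i => (R i).σ a (v i) := rfl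

theorem FinDimRep.inner_directSum (R : ι → FinDimRep 𝒜) (v w : PiLp 2 fun i => (R i).K) :
    inner ℂ (E := (directSum R).K) v w = ∑ i, ⟪v i, w i⟫_ℂ := PiLp.inner_apply v w

theorem FinDimRep.Subordinate.directSum {H : Type*} [NormedAddCommGroup H] [InnerProductSpace ℂ H]
    [CompleteSpace H] {π : 𝒜 →⋆ₐ[ℂ] (H →L[ℂ] H)} {R : ι → FinDimRep 𝒜}
    (hR : ∀ i, (R i).Subordinate π) : (FinDimRep.directSum R).Subordinate π := by
  intro a ha
  refine ContinuousLinearMap.ext fun (v : PiLp 2 fun i => (R i).K) => PiLp.ext fun i => ?_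
  change (R i).σ a (v i) = 0
  rw [hR i a ha, zero_apply]

end DirectSum

/-- Real-linear functionals on `κ → ℂ` are real parts of complex-linear ones. -/
theorem exists_eq_re_sum {κ : Type*} [Fintype κ] (f : (κ → ℂ) →ₗ[ℝ] ℝ) :
    ∃ c : κ → ℂ, ∀ y, f y = (∑ k, c k * y k).re := by
  classical
  refine ⟨fun k => f (Pi.single k 1) - Complex.I * f (Pi.single k Complex.I), fun y => ?_⟩
  conv_lhs => rw [← Finset.univ_sum_single y]
  rw [map_sum, Complex.re_sum]
  refine Finset.sum_congr rfl fun k _ => ?_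
  have : Pi.single k (y k) = (y k).re • Pi.single (M := fun _ => ℂ) k (1 : ℂ) +
      (y k).im • Pi.single (M := fun _ => ℂ) k Complex.I := by
    rw [← Pi.single_smul, ← Pi.single_smul, ← Pi.single_add]
    congr 1
    apply Complex.ext <;> simp
  rw [this, map_add, map_smul, map_smul]
  simp
  ring

section Approximation

variable {𝒜 : Type*} [CStarAlgebra 𝒜] {H : Type*} [NormedAddCommGroup H] [InnerProductSpace ℂ H]
  [CompleteSpace H] {n α : Type*}

/-- The arrays of matrix coefficients of a family `a` in representations subordinate to `π`. -/
def coefficientCone (π : 𝒜 →⋆ₐ[ℂ] (H →L[ℂ] H)) (n : Type*) (a : α → 𝒜) : Set (α × n × n → ℂ) :=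
  {y | ∃ R : FinDimRep 𝒜, R.Subordinate π ∧ ∃ v : n → R.K,
    ∀ k, y k = ⟪v k.2.1, R.σ (a k.1) (v k.2.2)⟫_ℂ}

theorem add_mem_coefficientCone {π : 𝒜 →⋆ₐ[ℂ] (H →L[ℂ] H)} {a : α → 𝒜} {x y : α × n × n → ℂ}
    (hx : x ∈ coefficientCone π n a) (hy : y ∈ coefficientCone π n a) :
    x + y ∈ coefficientCone π n a := by
  obtain ⟨R, hR, v, hv⟩ := hx
  obtain ⟨S, hS, w, hw⟩ := hy
  let T : Bool → FinDimRep 𝒜 := fun b => Bool.rec R S b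
  refine ⟨FinDimRep.directSum T, .directSum (by rintro (_ | _); exacts [hR, hS]),
    fun i => (WithLp.toLp 2 fun b => Bool.rec (v i) (w i) b : PiLp 2 fun b => (T b).K), fun k => ?_⟩
  rw [FinDimRep.directSum_apply, FinDimRep.inner_directSum, Fintype.sum_bool, add_comm, Pi.add_apply,
    hv, hw]

theorem smul_mem_coefficientCone {π : 𝒜 →⋆ₐ[ℂ] (H →L[ℂ] H)} {a : α → 𝒜} {x : α × n × n → ℂ}
    (hx : x ∈ coefficientCone π n a) {t : ℝ} (ht : 0 ≤ t) : t • x ∈ coefficientCone π n a := by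
  obtain ⟨R, hR, v, hv⟩ := hx
  refine ⟨R, hR, fun i => (√t : ℂ) • v i, fun k => ?_⟩
  rw [map_smul, inner_smul_left, inner_smul_right, Pi.smul_apply, hv, Complex.conj_ofReal,
    ← mul_assoc, ← Complex.ofReal_mul, Real.mul_self_sqrt ht, Complex.real_smul]

theorem zero_mem_coefficientCone (π : 𝒜 →⋆ₐ[ℂ] (H →L[ℂ] H)) (a : α → 𝒜) :
    0 ∈ coefficientCone π n a :=
  ⟨FinDimRep.directSum (ι := Empty) Empty.elim, .directSum (by rintro ⟨⟩), 0, fun k => by simp⟩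

theorem matrixForm_eq_sum [Fintype n] [Fintype α] (σ : 𝒜 →⋆ₐ[ℂ] (H →L[ℂ] H)) (a : α → 𝒜)
    (c : α × n × n → ℂ) {m : CStarMatrix n n 𝒜} (hm : ∀ i j, m i j = ∑ k, c (k, i, j) • a k)
    (v : n → H) :
    matrixForm σ m v = ∑ k, c k * ⟪v k.2.1, σ (a k.1) (v k.2.2)⟫_ℂ := by
  simp only [matrixForm, matrixAct, hm, map_sum, map_smul, sum_apply,
    smul_apply, inner_sum, inner_smul_right, Fintype.sum_prod_type]
  rw [Finset.sum_comm_cycle]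

theorem mem_closure_coefficientCone [Fintype n] [Fintype α] {π : 𝒜 →⋆ₐ[ℂ] (H →L[ℂ] H)}
    (hπ : IsRFDImage π) (a : α → 𝒜) (e : n → H) :
    (fun k => ⟪e k.2.1, π (a k.1) (e k.2.2)⟫_ℂ) ∈ closure (coefficientCone π n a) := by
  by_contra hnot
  have hconv : Convex ℝ (coefficientCone π n a) := fun x hx y hy s t hs ht _ =>
    add_mem_coefficientCone (smul_mem_coefficientCone hx hs) (smul_mem_coefficientCone hy ht)
  obtain ⟨f, u, hfu, hux⟩ :=
    geometric_hahn_banach_closed_point hconv.closure isClosed_closure hnot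
  obtain ⟨c, hc⟩ := exists_eq_re_sum (-f : (α × n × n → ℂ) →L[ℝ] ℝ).toLinearMap
  have hu : 0 < u := by
    simpa using hfu 0 (subset_closure (zero_mem_coefficientCone π a))
  have hneg : ∀ y ∈ coefficientCone π n a, f y ≤ 0 := by
    intro y hy
    by_contra! hpos
    have := hfu _ (subset_closure (smul_mem_coefficientCone hy (div_pos hu hpos).le))
    rw [map_smul, smul_eq_mul, div_mul_cancel₀ _ hpos.ne'] at this
    exact lt_irrefl _ this
  obtain ⟨m, hm⟩ : ∃ m : CStarMatrix n n 𝒜, ∀ i j, m i j = ∑ k, c (k, i, j) • a k :=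
    ⟨CStarMatrix.ofMatrix fun i j => ∑ k, c (k, i, j) • a k, fun _ _ => rfl⟩
  have h1 := re_matrixForm_nonneg hπ m (fun R hR v => by
    rw [matrixForm_eq_sum _ a c hm, ← hc]
    have := hneg _ ⟨R, hR, v, fun k => rfl⟩
    simpa using this) e
  rw [matrixForm_eq_sum _ a c hm, ← hc] at h1
  have h2 : f (fun k => ⟪e k.2.1, π (a k.1) (e k.2.2)⟫_ℂ) ≤ 0 := by simpa using h1
  linarith

/-- Finitely many matrix coefficients of `π` are approximated by those of a finite-dimensional
representation subordinate to `π`. -/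
theorem exists_norm_coefficient_sub_lt [Fintype n] [Fintype α] {π : 𝒜 →⋆ₐ[ℂ] (H →L[ℂ] H)}
    (hπ : IsRFDImage π) (a : α → 𝒜) (e : n → H) {ε : ℝ} (hε : 0 < ε) :
    ∃ R : FinDimRep 𝒜, R.Subordinate π ∧ ∃ v : n → R.K, ∀ k i j,
      ‖⟪v i, R.σ (a k) (v j)⟫_ℂ - ⟪e i, π (a k) (e j)⟫_ℂ‖ < ε := by
  obtain ⟨y, ⟨R, hR, v, hv⟩, hy⟩ :=
    Metric.mem_closure_iff.mp (mem_closure_coefficientCone hπ a e) ε hε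
  refine ⟨R, hR, v, fun k i j => ?_⟩
  rw [dist_comm, dist_eq_norm] at hy
  have := (norm_le_pi_norm _ (k, i, j)).trans_lt hy
  simpa [hv] using this

end Approximation

theorem abs_inv_sqrt_sub_one_le {x : ℝ} (hx : 1 / 2 ≤ x) : |(√x)⁻¹ - 1| ≤ |x - 1| := by
  have hs : 1 / 2 ≤ √x := Real.le_sqrt_of_sq_le (by linarith)
  have hx2 : √x * √x = x := Real.mul_self_sqrt (by linarith)
  have h1 : (√x)⁻¹ - 1 = (√x)⁻¹ * (1 - √x) := by field_simp
  have h2 : x - 1 = -((√x + 1) * (1 - √x)) := by linear_combination -hx2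
  rw [h1, h2, abs_neg, abs_mul, abs_mul, abs_of_nonneg (inv_nonneg.mpr (Real.sqrt_nonneg x)),
    abs_of_pos (by positivity : 0 < √x + 1)]
  refine mul_le_mul_of_nonneg_right ?_ (abs_nonneg _)
  rw [inv_le_comm₀ (by linarith) (by linarith), inv_le_iff_one_le_mul₀ (by linarith)]
  nlinarith

/-- A selfadjoint element close to `1` has an inverse square root close to `1`. -/
theorem IsSelfAdjoint.exists_inverse_sqrt {M : Type*} [CStarAlgebra M] {g : M}
    (hg : IsSelfAdjoint g) {δ : ℝ} (hδ : δ ≤ 1 / 2) (h : ‖g - 1‖ ≤ δ) :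
    ∃ t : M, IsSelfAdjoint t ∧ t * g * t = 1 ∧ ‖t - 1‖ ≤ δ := by
  have hδ0 : 0 ≤ δ := (norm_nonneg _).trans h
  have hspec : ∀ x ∈ spectrum ℝ g, |x - 1| ≤ δ := by
    intro x hx
    have h1 : x - 1 ∈ spectrum ℝ (g - 1) := by
      have := spectrum.sub_singleton_eq (R := ℝ) g 1
      rw [map_one] at this
      rw [← this]
      exact Set.sub_mem_sub hx rfl
    refine le_trans ?_ h
    exact IsometricContinuousFunctionalCalculus.norm_spectrum_le (g - 1) h1 (hg.sub (.one M))
  have hpos : ∀ x ∈ spectrum ℝ g, 1 / 2 ≤ x := fun x hx => by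
    have := (abs_le.mp (hspec x hx)).1; linarith
  have hcont : ContinuousOn (fun x : ℝ => (√x)⁻¹) (spectrum ℝ g) :=
    Real.continuous_sqrt.continuousOn.inv₀ fun x hx =>
      (Real.sqrt_pos.mpr (by linarith [hpos x hx])).ne'
  refine ⟨cfc (fun x : ℝ => (√x)⁻¹) g, cfc_predicate _ g, ?_, ?_⟩
  · nth_rw 2 [← cfc_id' ℝ g]
    rw [← cfc_mul _ _ g, ← cfc_mul _ _ g, ← cfc_one ℝ g]
    refine cfc_congr fun x hx => ?_
    have hs : 0 < √x := Real.sqrt_pos.mpr (by linarith [hpos x hx])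
    have hx2 : √x * √x = x := Real.mul_self_sqrt (by linarith [hpos x hx])
    simp only [Pi.one_apply]
    field_simp
    linarith
  · rw [← cfc_one ℝ g, ← cfc_sub _ _ g]
    refine norm_cfc_le hδ0 fun x hx => ?_
    exact (abs_inv_sqrt_sub_one_le (hpos x hx)).trans (hspec x hx)

theorem inner_sum_smul_apply_sum_smul {K : Type*} [NormedAddCommGroup K] [InnerProductSpace ℂ K]
    {ι : Type*} [Fintype ι] (c d : ι → ℂ) (v : ι → K) (S : K →L[ℂ] K) :
    ⟪∑ i, c i • v i, S (∑ j, d j • v j)⟫_ℂ =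
      ∑ i, ∑ j, (starRingEnd ℂ) (c i) * (d j * ⟪v i, S (v j)⟫_ℂ) := by
  simp only [map_sum, map_smul, inner_sum, sum_inner, inner_smul_left, inner_smul_right,
    Finset.mul_sum]
  rw [Finset.sum_comm]
  exact Finset.sum_congr rfl fun i _ => Finset.sum_congr rfl fun j _ => by ring

section IsometricApproximation

variable {𝒜 : Type*} [CStarAlgebra 𝒜] {H : Type*} [NormedAddCommGroup H] [InnerProductSpace ℂ H]
  [CompleteSpace H]

theorem exists_linearMap_norm_inner_sub_le {π : 𝒜 →⋆ₐ[ℂ] (H →L[ℂ] H)} (hπ : IsRFDImage π)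
    (W : Submodule ℂ H) [FiniteDimensional ℂ W] (F : Finset 𝒜) {ε : ℝ} (hε : 0 < ε) :
    ∃ R : FinDimRep 𝒜, R.Subordinate π ∧ ∃ V : W →ₗ[ℂ] R.K, ∀ b ∈ F, ∀ u w : W,
      ‖⟪V u, R.σ b (V w)⟫_ℂ - ⟪(u : H), π b w⟫_ℂ‖ ≤ ε * ‖u‖ * ‖w‖ := by
  let e := stdOrthonormalBasis ℂ W
  set m := Module.finrank ℂ W
  obtain ⟨R, hR, v, hv⟩ := exists_norm_coefficient_sub_lt hπ (fun k : F => (k : 𝒜))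
    (fun i => (e i : H)) (ε := ε / (m ^ 2 + 1)) (by positivity)
  refine ⟨R, hR, Fintype.linearCombination ℂ v ∘ₗ (WithLp.linearEquiv 2 ℂ _).toLinearMap ∘ₗ
    e.repr.toLinearMap, fun b hb u w => ?_⟩
  have hV : ∀ u : W, (Fintype.linearCombination ℂ v ∘ₗ (WithLp.linearEquiv 2 ℂ _).toLinearMap ∘ₗ
      e.repr.toLinearMap) u = ∑ i, e.repr u i • v i := fun u => by
    simp [Fintype.linearCombination_apply]
  have hW : ∀ u : W, (u : H) = ∑ i, e.repr u i • (e i : H) := fun u => by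
    conv_lhs => rw [← e.sum_repr u]
    simp
  have hc : ∀ (u : W) i, ‖e.repr u i‖ ≤ ‖u‖ := fun u i =>
    (PiLp.norm_apply_le (e.repr u) i).trans_eq (e.repr.norm_map u)
  rw [hV, hV, hW u, hW w]
  rw [inner_sum_smul_apply_sum_smul, inner_sum_smul_apply_sum_smul, ← Finset.sum_sub_distrib]
  simp only [← Finset.sum_sub_distrib, ← mul_sub]
  calc _ ≤ ∑ i : Fin m, ∑ j : Fin m, ‖u‖ * (‖w‖ * (ε / (m ^ 2 + 1))) := by
        refine norm_sum_le_of_le _ fun i _ => norm_sum_le_of_le _ fun j _ => ?_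
        rw [norm_mul, norm_mul, RCLike.norm_conj]
        gcongr
        exacts [hc u i, hc w j, (hv ⟨b, hb⟩ i j).le]
    _ = (ε / (m ^ 2 + 1)) * m ^ 2 * (‖u‖ * ‖w‖) := by simp; ring
    _ ≤ ε * (‖u‖ * ‖w‖) := by
        gcongr
        rw [div_mul_eq_mul_div, div_le_iff₀ (by positivity)]
        nlinarith
    _ = _ := by ring

/-- Compressions of `π` to a finite-dimensional subspace are approximated by compressions of
finite-dimensional representations subordinate to `π`. -/
theorem exists_linearIsometry_norm_inner_sub_le {π : 𝒜 →⋆ₐ[ℂ] (H →L[ℂ] H)} (hπ : IsRFDImage π)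
    (W : Submodule ℂ H) [FiniteDimensional ℂ W] (F : Finset 𝒜) {ε : ℝ} (hε : 0 < ε) :
    ∃ R : FinDimRep 𝒜, R.Subordinate π ∧ ∃ V : W →ₗᵢ[ℂ] R.K, ∀ b ∈ F, ∀ u w : W,
      ‖⟪V u, R.σ b (V w)⟫_ℂ - ⟪(u : H), π b w⟫_ℂ‖ ≤ ε * ‖u‖ * ‖w‖ := by
  classical
  obtain ⟨M, hM0, hM⟩ : ∃ M : ℝ, 0 ≤ M ∧ ∀ b ∈ F, ‖π b‖ ≤ M :=
    ⟨∑ b ∈ F, ‖π b‖, by positivity, fun b hb =>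
      Finset.single_le_sum (f := fun b => ‖π b‖) (fun _ _ => norm_nonneg _) hb⟩
  set δ := min (1 / 2) (ε / (4 + 3 * M)) with hδ
  have hδ0 : 0 < δ := lt_min (by norm_num) (by positivity)
  have hδ1 : δ ≤ 1 / 2 := min_le_left _ _
  have hδ2 : δ * (4 + 3 * M) ≤ ε := by
    rw [← le_div_iff₀ (by positivity)]
    exact min_le_right _ _
  obtain ⟨R, hR, V, hV⟩ := exists_linearMap_norm_inner_sub_le hπ W (insert 1 F) hδ0
  let V' : W →L[ℂ] R.K := LinearMap.toContinuousLinearMap V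
  have hV' : ∀ w, V' w = V w := fun _ => rfl
  set G : W →L[ℂ] W := ContinuousLinearMap.adjoint V' ∘L V' with hG
  have hGsa : IsSelfAdjoint G := by
    rw [ContinuousLinearMap.isSelfAdjoint_iff', hG, ContinuousLinearMap.adjoint_comp,
      ContinuousLinearMap.adjoint_adjoint]
  have hGi : ∀ u w, ⟪u, G w⟫_ℂ = ⟪V u, V w⟫_ℂ := fun u w => by
    rw [hG, ContinuousLinearMap.comp_apply, ContinuousLinearMap.adjoint_inner_right, hV', hV']
  have hGn : ‖G - 1‖ ≤ δ := by
    refine ContinuousLinearMap.opNorm_le_bound _ hδ0.le fun w => ?_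
    have h1 := hV 1 (Finset.mem_insert_self _ _) ((G - 1) w) w
    have h2 : ⟪V ((G - 1) w), R.σ 1 (V w)⟫_ℂ - ⟪(((G - 1) w : W) : H), π 1 w⟫_ℂ =
        ⟪(G - 1) w, (G - 1) w⟫_ℂ := by
      rw [map_one, map_one, one_apply_eq_self, one_apply_eq_self, ← hGi, ← Submodule.coe_inner,
        ← inner_sub_right]
      rfl
    rw [h2, inner_self_eq_norm_sq_to_K, norm_pow, RCLike.norm_ofReal, abs_norm, sq,
      mul_right_comm] at h1
    rcases (norm_nonneg ((G - 1) w)).eq_or_lt with h0 | h0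
    · rw [← h0]; positivity
    · exact le_of_mul_le_mul_right h1 h0
  obtain ⟨T, hTsa, hTG, hT⟩ := IsSelfAdjoint.exists_inverse_sqrt (M := W →L[ℂ] W) hGsa hδ1 hGn
  have hTi : ∀ u w, ⟪T u, w⟫_ℂ = ⟪u, T w⟫_ℂ := fun u w => by
    rw [← ContinuousLinearMap.adjoint_inner_right, hTsa.adjoint_eq]
  have hTn : ∀ u, ‖T u - u‖ ≤ δ * ‖u‖ := fun u =>
    (T - 1).le_of_opNorm_le hT u
  have hTn2 : ∀ u, ‖T u‖ ≤ 2 * ‖u‖ := fun u => by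
    have h1 := norm_add_le (T u - u) u
    rw [sub_add_cancel] at h1
    nlinarith [hTn u, norm_nonneg u]
  refine ⟨R, hR, (V ∘ₗ T.toLinearMap).isometryOfInner fun u w => ?_, fun b hb u w => ?_⟩
  · change ⟪V (T u), V (T w)⟫_ℂ = ⟪u, w⟫_ℂ
    rw [← hGi, hTi]
    exact congrArg (fun S : W →L[ℂ] W => ⟪u, S w⟫_ℂ) hTG
  · change ‖⟪V (T u), R.σ b (V (T w))⟫_ℂ - ⟪(u : H), π b w⟫_ℂ‖ ≤ _
    have h1 := hV b (Finset.mem_insert_of_mem hb) (T u) (T w)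
    have h2 : ⟪V (T u), R.σ b (V (T w))⟫_ℂ - ⟪(u : H), π b w⟫_ℂ =
      (⟪V (T u), R.σ b (V (T w))⟫_ℂ - ⟪((T u : W) : H), π b (T w : W)⟫_ℂ) +
      ⟪((T u - u : W) : H), π b (T w : W)⟫_ℂ + ⟪(u : H), π b (T w - w : W)⟫_ℂ := by
      push_cast
      rw [inner_sub_left, map_sub, inner_sub_right]
      ring
    have h3 : ‖⟪((T u - u : W) : H), π b (T w : W)⟫_ℂ‖ ≤ δ * ‖u‖ * (M * (2 * ‖w‖)) :=
      (norm_inner_le_norm _ _).trans <| mul_le_mul (hTn u)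
        (((π b).le_of_opNorm_le (hM b hb) _).trans (by gcongr; exact hTn2 w)) (norm_nonneg _)
        (by positivity)
    have h4 : ‖⟪(u : H), π b (T w - w : W)⟫_ℂ‖ ≤ ‖u‖ * (M * (δ * ‖w‖)) :=
      (norm_inner_le_norm _ _).trans <| mul_le_mul le_rfl
        (((π b).le_of_opNorm_le (hM b hb) _).trans (by gcongr; exact hTn w)) (norm_nonneg _)
        (norm_nonneg _)
    have h5 : δ * ‖T u‖ * ‖T w‖ ≤ δ * (2 * ‖u‖) * (2 * ‖w‖) := by
      gcongr
      exacts [hTn2 u, hTn2 w]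
    rw [h2]
    calc _ ≤ δ * (2 * ‖u‖) * (2 * ‖w‖) + δ * ‖u‖ * (M * (2 * ‖w‖)) + ‖u‖ * (M * (δ * ‖w‖)) :=
          norm_add_le_of_le (norm_add_le_of_le (h1.trans h5) h3) h4
      _ = δ * (4 + 3 * M) * ‖u‖ * ‖w‖ := by ring
      _ ≤ ε * ‖u‖ * ‖w‖ := by gcongr

end IsometricApproximation

/-- Two isometries into spaces of equal finite dimension differ by a unitary. -/
theorem LinearIsometry.exists_linearIsometryEquiv {W K K' : Type*} [NormedAddCommGroup W]
    [InnerProductSpace ℂ W] [NormedAddCommGroup K] [InnerProductSpace ℂ K] [FiniteDimensional ℂ K]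
    [NormedAddCommGroup K'] [InnerProductSpace ℂ K'] [FiniteDimensional ℂ K']
    (h : Module.finrank ℂ K = Module.finrank ℂ K') (S : W →ₗᵢ[ℂ] K) (T : W →ₗᵢ[ℂ] K') :
    ∃ U : K ≃ₗᵢ[ℂ] K', ∀ w, U (S w) = T w := by
  let U₀ : K ≃ₗᵢ[ℂ] K' := (stdOrthonormalBasis ℂ K).repr.trans
    ((stdOrthonormalBasis ℂ K').reindex (finCongr h.symm)).repr.symm
  let L : LinearMap.range S.toLinearMap →ₗᵢ[ℂ] K :=
    U₀.symm.toLinearIsometry.comp (T.comp S.equivRange.symm.toLinearIsometry)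
  refine ⟨(L.extend.toLinearIsometryEquiv rfl).trans U₀, fun w => ?_⟩
  have h1 : L.extend (S w) = L ⟨S w, w, rfl⟩ := L.extend_apply ⟨S w, w, rfl⟩
  have h2 : S.equivRange.symm ⟨S w, w, rfl⟩ = w := by
    rw [LinearIsometryEquiv.symm_apply_eq]
    rfl
  rw [LinearIsometryEquiv.trans_apply, LinearIsometry.toLinearIsometryEquiv_apply, h1]
  change U₀ (U₀.symm (T (S.equivRange.symm ⟨S w, w, rfl⟩))) = T w
  rw [h2, LinearIsometryEquiv.apply_symm_apply]

section Gluing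

variable {𝒜 ℬ : Type*} [CStarAlgebra 𝒜] [CStarAlgebra ℬ] {W : Type*} [NormedAddCommGroup W]
  [InnerProductSpace ℂ W]

/-- A representation on a space of dimension `N` can be moved to `EuclideanSpace ℂ (Fin N)` along
any prescribed isometry. -/
theorem FinDimRep.exists_transfer (R : FinDimRep 𝒜) {N : ℕ} (hN : Module.finrank ℂ R.K = N)
    (V : W →ₗᵢ[ℂ] R.K) (V₀ : W →ₗᵢ[ℂ] EuclideanSpace ℂ (Fin N)) :
    ∃ ρ : 𝒜 →⋆ₐ[ℂ] (EuclideanSpace ℂ (Fin N) →L[ℂ] EuclideanSpace ℂ (Fin N)),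
      (∀ a, R.σ a = 0 → ρ a = 0) ∧
      ∀ a u w, ⟪V₀ u, ρ a (V₀ w)⟫_ℂ = ⟪V u, R.σ a (V w)⟫_ℂ := by
  obtain ⟨U, hU⟩ := LinearIsometry.exists_linearIsometryEquiv (by simpa using hN) V V₀
  refine ⟨(U.conjStarAlgEquiv : _ →⋆ₐ[ℂ] _).comp R.σ, fun a ha => ?_, fun a u w => ?_⟩
  · change U.conjStarAlgEquiv (R.σ a) = 0
    rw [ha, map_zero]
  · change ⟪V₀ u, U.conjStarAlgEquiv (R.σ a) (V₀ w)⟫_ℂ = _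
    rw [← hU, ← hU, LinearIsometryEquiv.conjStarAlgEquiv_apply_apply,
      LinearIsometryEquiv.symm_apply_apply, LinearIsometryEquiv.inner_map_map]

/-- The `q`-fold multiple of a representation. -/
def FinDimRep.amplify (R : FinDimRep 𝒜) (q : ℕ) : FinDimRep 𝒜 :=
  FinDimRep.directSum fun _ : Fin q => R

theorem FinDimRep.finrank_amplify (R : FinDimRep 𝒜) (q : ℕ) :
    Module.finrank ℂ (R.amplify q).K = q * Module.finrank ℂ R.K := by
  have : Module.finrank ℂ (R.amplify q).K = Module.finrank ℂ (Fin q → R.K) :=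
    (WithLp.linearEquiv 2 ℂ (Fin q → R.K)).finrank_eq
  rw [this, Module.finrank_pi_fintype]
  simp

theorem FinDimRep.amplify_apply_eq_zero {R : FinDimRep 𝒜} {q : ℕ} {a : 𝒜} (h : R.σ a = 0) :
    (R.amplify q).σ a = 0 := by
  refine ContinuousLinearMap.ext fun (v : PiLp 2 fun _ : Fin q => R.K) => PiLp.ext fun i => ?_
  change R.σ a (v i) = 0
  rw [h, zero_apply]

theorem FinDimRep.exists_linearIsometry_amplify (R : FinDimRep 𝒜) {q : ℕ} (hq : 0 < q)
    (V : W →ₗᵢ[ℂ] R.K) : ∃ V' : W →ₗᵢ[ℂ] (R.amplify q).K,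
      ∀ a u w, ⟪V' u, (R.amplify q).σ a (V' w)⟫_ℂ = ⟪V u, R.σ a (V w)⟫_ℂ := by
  let i₀ : Fin q := ⟨0, hq⟩
  let L : W →ₗ[ℂ] PiLp 2 fun _ : Fin q => R.K :=
    (WithLp.linearEquiv 2 ℂ (Fin q → R.K)).symm.toLinearMap ∘ₗ
      LinearMap.single ℂ (fun _ : Fin q => R.K) i₀ ∘ₗ V.toLinearMap
  have hL : ∀ a u w, inner ℂ (E := (R.amplify q).K) (L u) ((R.amplify q).σ a (L w)) =
      ⟪V u, R.σ a (V w)⟫_ℂ := by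
    intro a u w
    refine (FinDimRep.inner_directSum _ _ _).trans ?_
    rw [Finset.sum_eq_single i₀]
    · change ⟪(Pi.single i₀ (V u) : Fin q → R.K) i₀,
        R.σ a ((Pi.single i₀ (V w) : Fin q → R.K) i₀)⟫_ℂ = _
      rw [Pi.single_eq_same, Pi.single_eq_same]
    · intro j _ hj
      change ⟪(Pi.single i₀ (V u) : Fin q → R.K) j, _⟫_ℂ = _
      rw [Pi.single_eq_of_ne hj, inner_zero_left]
    · simp
  exact ⟨LinearMap.isometryOfInner (E' := (R.amplify q).K) L fun u w => by
    have := hL 1 u w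
    rw [map_one, map_one] at this
    exact this.trans (V.inner_map_map u w), hL⟩

/-- Two finite-dimensional representations, each with an isometry from `W`, can be moved to a
common space with a common isometry. -/
theorem FinDimRep.exists_glue [Nontrivial W] (R : FinDimRep 𝒜) (S : FinDimRep ℬ)
    (V : W →ₗᵢ[ℂ] R.K) (T : W →ₗᵢ[ℂ] S.K) :
    ∃ (N : ℕ) (V₀ : W →ₗᵢ[ℂ] EuclideanSpace ℂ (Fin N))
      (ρ : 𝒜 →⋆ₐ[ℂ] (EuclideanSpace ℂ (Fin N) →L[ℂ] EuclideanSpace ℂ (Fin N)))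
      (τ : ℬ →⋆ₐ[ℂ] (EuclideanSpace ℂ (Fin N) →L[ℂ] EuclideanSpace ℂ (Fin N))),
      (∀ a, R.σ a = 0 → ρ a = 0) ∧ (∀ b, S.σ b = 0 → τ b = 0) ∧
      (∀ a u w, ⟪V₀ u, ρ a (V₀ w)⟫_ℂ = ⟪V u, R.σ a (V w)⟫_ℂ) ∧
      ∀ b u w, ⟪V₀ u, τ b (V₀ w)⟫_ℂ = ⟪T u, S.σ b (T w)⟫_ℂ := by
  have := V.injective.nontrivial
  have := T.injective.nontrivial
  obtain ⟨V', hV'⟩ := R.exists_linearIsometry_amplify (Module.finrank_pos (R := ℂ) (M := S.K)) V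
  obtain ⟨T', hT'⟩ := S.exists_linearIsometry_amplify (Module.finrank_pos (R := ℂ) (M := R.K)) T
  have hR := R.finrank_amplify (Module.finrank ℂ S.K)
  have hS := (S.finrank_amplify (Module.finrank ℂ R.K)).trans (mul_comm _ _)
  let V₀ := (((stdOrthonormalBasis ℂ (R.amplify (Module.finrank ℂ S.K)).K).reindex
    (finCongr hR)).repr.toLinearIsometry).comp V'
  obtain ⟨ρ, hρ, hρV⟩ := FinDimRep.exists_transfer _ hR V' V₀
  obtain ⟨τ, hτ, hτV⟩ := FinDimRep.exists_transfer _ hS T' V₀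
  exact ⟨_, V₀, ρ, τ, fun a ha => hρ a (amplify_apply_eq_zero ha),
    fun b hb => hτ b (amplify_apply_eq_zero hb), fun a u w => (hρV a u w).trans (hV' a u w),
    fun b u w => (hτV b u w).trans (hT' b u w)⟩

end Gluing

/-- A non-unital representation of a unital algebra becomes unital on the range of the unit. -/
theorem FinDimRep.exists_compress {𝒜 : Type*} [CStarAlgebra 𝒜] {K : Type} [NormedAddCommGroup K]
    [InnerProductSpace ℂ K] [FiniteDimensional ℂ K] [CompleteSpace K]
    (φ : 𝒜 →⋆ₙₐ[ℂ] (K →L[ℂ] K)) : ∃ R : FinDimRep 𝒜, ∀ a, R.σ a = 0 ↔ φ a = 0 := by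
  let S : Submodule ℂ K := LinearMap.range (φ 1).toLinearMap
  have hS : ∀ a v, φ a v ∈ S := fun a v => ⟨φ a v, by
    change (φ 1 * φ a) v = φ a v
    rw [← map_mul, one_mul]⟩
  have h1 : ∀ v : S, φ 1 v = v := by
    rintro ⟨_, w, rfl⟩
    change (φ 1 * φ 1) w = φ 1 w
    rw [← map_mul, one_mul]
  let σ : 𝒜 →⋆ₐ[ℂ] (S →L[ℂ] S) :=
    { toFun a := ((φ a).comp S.subtypeL).codRestrict S fun v => hS a v
      map_one' := by ext v; exact h1 v
      map_mul' a b := by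
        ext v
        change φ (a * b) v = (φ a * φ b) v
        rw [map_mul]
      map_zero' := by ext v; simp
      map_add' a b := by
        ext v
        change φ (a + b) v = φ a v + φ b v
        rw [map_add, add_apply]
      commutes' c := by
        ext v
        change φ (algebraMap ℂ 𝒜 c) v = c • (v : K)
        rw [Algebra.algebraMap_eq_smul_one, map_smul, smul_apply, h1]
      map_star' a := by
        rw [ContinuousLinearMap.star_eq_adjoint, ContinuousLinearMap.eq_adjoint_iff]
        intro v w
        change ⟪φ (star a) v, (w : K)⟫_ℂ = ⟪(v : K), φ a w⟫_ℂ
        rw [map_star, ContinuousLinearMap.star_eq_adjoint, ContinuousLinearMap.adjoint_inner_left] }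
  refine ⟨{ K := S, σ := σ }, fun a => ⟨fun h => ?_, fun h => ?_⟩⟩
  · ext v
    have h2 : σ a ⟨φ 1 v, v, rfl⟩ = 0 := by
      change σ a = 0 at h
      rw [h, zero_apply]
    have h3 : (φ a * φ 1) v = 0 := congrArg Subtype.val h2
    rwa [← map_mul, mul_one] at h3
  · change σ a = 0
    ext v
    change φ a v = 0
    rw [h, zero_apply]

theorem IsStronglyRFD.isRFDImage_starLift {A H : Type} [NonUnitalCStarAlgebra A]
    [NormedAddCommGroup H] [InnerProductSpace ℂ H] [CompleteSpace H] (hA : IsStronglyRFD A)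
    (π : A →⋆ₙₐ[ℂ] (H →L[ℂ] H)) : IsRFDImage (Unitization.starLift π) := by
  let S : NonUnitalStarSubalgebra ℂ (H →L[ℂ] H) := NonUnitalStarAlgHom.range π
  have hS : IsClosed (S : Set (H →L[ℂ] H)) := π.isClosed_range
  let q : A →⋆ₙₐ[ℂ] S := NonUnitalStarAlgHom.rangeRestrict π
  have hrfd : IsRFD S := hA S q (by rintro ⟨_, a, rfl⟩; exact ⟨a, rfl⟩)
  have hlift : ∀ x, Unitization.starLift π x = algebraMap ℂ (H →L[ℂ] H) x.fst + π x.snd :=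
    fun x => rfl
  intro x hx
  by_cases hu : ∃ u, π u = 1
  · obtain ⟨u, hu⟩ := hu
    have hmem : ∀ y, Unitization.starLift π y ∈ S := fun y => ⟨y.fst • u + y.snd, by
      change π (y.fst • u + y.snd) = _
      rw [hlift, map_add, map_smul, hu, Algebra.algebraMap_eq_smul_one]⟩
    let p : Unitization ℂ A →⋆ₙₐ[ℂ] S :=
      NonUnitalStarAlgHom.codRestrict (Unitization.starLift π : Unitization ℂ A →⋆ₙₐ[ℂ] _) S hmem
    have hp : ∀ y, p y = ⟨Unitization.starLift π y, hmem y⟩ := fun _ => rfl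
    obtain ⟨n, φ, hφ⟩ := hrfd (p x) fun h => hx (congrArg Subtype.val h)
    obtain ⟨R, hR⟩ := FinDimRep.exists_compress (φ.comp p)
    refine ⟨R, fun y hy => (hR y).mpr ?_, fun h => hφ ((hR x).mp h)⟩
    have : p y = 0 := Subtype.ext hy
    change φ (p y) = 0
    rw [this, map_zero]
  · have hfst : ∀ y, Unitization.starLift π y = 0 → y.fst = 0 := by
      intro y hy
      by_contra h
      refine hu ⟨-(y.fst⁻¹ • y.snd), ?_⟩
      rw [hlift, add_comm, Algebra.algebraMap_eq_smul_one] at hy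
      rw [map_neg, map_smul, eq_neg_of_add_eq_zero_left hy, smul_neg, neg_neg, smul_smul,
        inv_mul_cancel₀ h, one_smul]
    by_cases h0 : x.fst = 0
    · have hx' : q x.snd ≠ 0 := by
        intro h
        refine hx ?_
        rw [hlift, h0, map_zero, zero_add]
        exact congrArg Subtype.val h
      obtain ⟨n, φ, hφ⟩ := hrfd _ hx'
      refine ⟨{ K := EuclideanSpace ℂ (Fin n), σ := Unitization.starLift (φ.comp q) },
        fun y hy => ?_, ?_⟩
      · have h1 := hfst y hy
        rw [hlift, h1, map_zero, zero_add] at hy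
        have h2 : q y.snd = 0 := Subtype.ext hy
        change algebraMap ℂ _ y.fst + φ (q y.snd) = 0
        rw [h1, h2, map_zero, map_zero, add_zero]
      · change algebraMap ℂ _ x.fst + φ (q x.snd) ≠ 0
        rwa [h0, map_zero, zero_add]
    · refine ⟨{ K := EuclideanSpace ℂ (Fin 1), σ := Unitization.starLift 0 }, fun y hy => ?_, ?_⟩
      · change algebraMap ℂ (EuclideanSpace ℂ (Fin 1) →L[ℂ] EuclideanSpace ℂ (Fin 1)) y.fst + 0 = 0
        rw [hfst y hy, map_zero, add_zero]
      · change algebraMap ℂ (EuclideanSpace ℂ (Fin 1) →L[ℂ] EuclideanSpace ℂ (Fin 1)) x.fst + 0 ≠ 0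
        rw [add_zero]
        exact (map_ne_zero_iff _ (algebraMap ℂ _).injective).mpr h0

section Density

variable {D : Type*} [NonUnitalCStarAlgebra D]

/-- Induction for a self-adjoint set generating a dense subalgebra. -/
theorem NonUnitalStarAlgebra.dense_adjoin_induction {s : Set D} (hs : star s ⊆ s)
    (hd : closure (NonUnitalStarAlgebra.adjoin ℂ s : Set D) = Set.univ) {p : D → Prop}
    (h_mem : ∀ x ∈ s, p x) (h_zero : p 0) (h_add : ∀ x y, p x → p y → p (x + y))
    (h_mul : ∀ x y, p x → p y → p (x * y)) (h_smul : ∀ (c : ℂ) x, p x → p (c • x))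
    (h_closed : IsClosed {x | p x}) (x : D) : p x := by
  have h : (NonUnitalStarAlgebra.adjoin ℂ s : Set D) ⊆ {x | p x} := by
    intro y hy
    refine NonUnitalAlgebra.adjoin_induction (p := fun x _ => p x) (fun z hz => ?_)
      (fun x y _ _ => h_add x y) h_zero (fun x y _ _ => h_mul x y) (fun c x _ => h_smul c x) hy
    exact h_mem z (hz.elim id fun h => hs h)
  have hx : x ∈ closure (NonUnitalStarAlgebra.adjoin ℂ s : Set D) := hd ▸ Set.mem_univ x
  exact h_closed.closure_subset_iff.mpr h hx

variable {H : Type*} [NormedAddCommGroup H] [InnerProductSpace ℂ H] [CompleteSpace H]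
  {ι : Type*} {l : Filter ι} {E : ι → Type*} [∀ i, NormedAddCommGroup (E i)]
  [∀ i, InnerProductSpace ℂ (E i)] [∀ i, CompleteSpace (E i)]

open Filter Topology

/-- Asymptotic intertwining of representations passes from generators to the whole algebra. -/
theorem tendsto_norm_intertwine_sub {π : D →⋆ₙₐ[ℂ] (H →L[ℂ] H)}
    {θ : ∀ i, D →⋆ₙₐ[ℂ] (E i →L[ℂ] E i)} {T : ∀ i, H →L[ℂ] E i} (hT : ∀ i x, ‖T i x‖ ≤ ‖x‖)
    {s : Set D} (hs : star s ⊆ s)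
    (hd : closure (NonUnitalStarAlgebra.adjoin ℂ s : Set D) = Set.univ)
    (h : ∀ d ∈ s, ∀ x, Tendsto (fun i => ‖T i (π d x) - θ i d (T i x)‖) l (𝓝 0)) (d : D) :
    ∀ x, Tendsto (fun i => ‖T i (π d x) - θ i d (T i x)‖) l (𝓝 0) := by
  have hθ : ∀ i d v, ‖θ i d v‖ ≤ ‖d‖ * ‖v‖ := fun i d v =>
    (θ i d).le_of_opNorm_le (NonUnitalStarAlgHom.norm_apply_le (θ i) d) v
  have hπ : ∀ d v, ‖π d v‖ ≤ ‖d‖ * ‖v‖ := fun d v =>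
    (π d).le_of_opNorm_le (NonUnitalStarAlgHom.norm_apply_le π d) v
  refine NonUnitalStarAlgebra.dense_adjoin_induction hs hd h (fun x => ?_)
    (fun a b ha hb x => ?_) (fun a b ha hb x => ?_) (fun c a ha x => ?_) ?_ d
  · simp [tendsto_const_nhds]
  · refine squeeze_zero (fun i => norm_nonneg _) (fun i => ?_)
      (by simpa using (ha x).add (hb x))
    refine le_trans (le_of_eq ?_) (norm_add_le _ _)
    simp only [map_add, add_apply]
    congr 1
    abel
  · refine squeeze_zero (fun i => norm_nonneg _) (fun i => ?_)
      (by simpa using (ha (π b x)).add ((hb x).const_mul ‖a‖))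
    refine le_trans (le_trans (le_of_eq ?_) (norm_add_le _ _))
      (add_le_add_right (hθ i a (T i (π b x) - θ i b (T i x))) _)
    simp only [map_mul, mul_apply_eq_comp, map_sub]
    congr 1
    abel
  · refine squeeze_zero (fun i => norm_nonneg _) (fun i => le_of_eq ?_)
      (by simpa using (ha x).const_mul ‖c‖)
    simp only [map_smul, smul_apply, ← smul_sub, norm_smul]
  · refine isClosed_of_closure_subset fun a ha x => ?_
    rw [Metric.tendsto_nhds]
    intro ε hε
    obtain ⟨b, hb, hab⟩ := Metric.mem_closure_iff.mp ha (ε / (4 * (‖x‖ + 1))) (by positivity)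
    filter_upwards [(Metric.tendsto_nhds.mp (hb x)) (ε / 2) (by positivity)] with i hi
    rw [dist_zero_right, norm_norm] at hi ⊢
    have e : T i (π a x) - θ i a (T i x) = T i (π b x) - θ i b (T i x) +
        (T i (π (a - b) x) - θ i (a - b) (T i x)) := by
      simp only [map_sub, sub_apply]
      abel
    have h1 : ‖T i (π (a - b) x)‖ ≤ ‖a - b‖ * ‖x‖ := (hT i _).trans (hπ _ _)
    have h2 : ‖θ i (a - b) (T i x)‖ ≤ ‖a - b‖ * ‖x‖ :=
      (hθ i _ _).trans (mul_le_mul_of_nonneg_left (hT i x) (norm_nonneg _))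
    have h3 : ‖a - b‖ * ‖x‖ ≤ ε / 4 := by
      rw [dist_eq_norm] at hab
      calc _ ≤ ε / (4 * (‖x‖ + 1)) * (‖x‖ + 1) := by gcongr; linarith
        _ = ε / 4 := by field_simp
    rw [e]
    have h4 := norm_add_le (T i (π b x) - θ i b (T i x)) (T i (π (a - b) x) - θ i (a - b) (T i x))
    have h5 := norm_sub_le (T i (π (a - b) x)) (θ i (a - b) (T i x))
    linarith

end Density

section Stage

variable {𝒜 ℬ : Type*} [CStarAlgebra 𝒜] [CStarAlgebra ℬ] {H : Type*} [NormedAddCommGroup H]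
  [InnerProductSpace ℂ H] [CompleteSpace H]

theorem norm_isometry_sub_sq_le {W K : Type*} [NormedAddCommGroup W] [InnerProductSpace ℂ W]
    [NormedAddCommGroup K] [InnerProductSpace ℂ K] [CompleteSpace K] (V : W →ₗᵢ[ℂ] K)
    (t : K →L[ℂ] K) {x y : W} {ε : ℝ}
    (h₁ : ‖⟪V y, t (V x)⟫_ℂ - ⟪y, y⟫_ℂ‖ ≤ ε * ‖y‖ * ‖x‖)
    (h₂ : ‖⟪V x, (star t * t) (V x)⟫_ℂ - ⟪y, y⟫_ℂ‖ ≤ ε * ‖x‖ * ‖x‖) :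
    ‖V y - t (V x)‖ ^ 2 ≤ ε * (2 * ‖y‖ * ‖x‖ + ‖x‖ * ‖x‖) := by
  have e2 : ⟪V x, (star t * t) (V x)⟫_ℂ = ⟪t (V x), t (V x)⟫_ℂ := by
    rw [mul_apply_eq_comp, ContinuousLinearMap.star_eq_adjoint,
      ContinuousLinearMap.adjoint_inner_right]
  rw [e2] at h₂
  have r1 := (Complex.abs_re_le_norm _).trans h₁
  have r2 := (Complex.abs_re_le_norm _).trans h₂
  have n1 : (⟪y, y⟫_ℂ).re = ‖y‖ ^ 2 := inner_self_eq_norm_sq (𝕜 := ℂ) y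
  have n2 : (⟪t (V x), t (V x)⟫_ℂ).re = ‖t (V x)‖ ^ 2 := inner_self_eq_norm_sq (𝕜 := ℂ) _
  rw [Complex.sub_re, n1, abs_le] at r1 r2
  rw [n2] at r2
  have n3 : ‖V y - t (V x)‖ ^ 2 = ‖V y‖ ^ 2 - 2 * (⟪V y, t (V x)⟫_ℂ).re + ‖t (V x)‖ ^ 2 :=
    norm_sub_sq (𝕜 := ℂ) _ _
  rw [n3, V.norm_map]
  nlinarith [r1.1, r2.2]

/-- Simultaneous approximate compression of two representations with residually finite-dimensional
images to representations on a common finite-dimensional space. -/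
theorem exists_common_approximation {π : 𝒜 →⋆ₐ[ℂ] (H →L[ℂ] H)} (hπ : IsRFDImage π)
    {τ : ℬ →⋆ₐ[ℂ] (H →L[ℂ] H)} (hτ : IsRFDImage τ) (W : Submodule ℂ H) [FiniteDimensional ℂ W]
    [Nontrivial W] (F : Set 𝒜) (hF : F.Finite) (G : Set ℬ) (hG : G.Finite) {ε : ℝ} (hε : 0 < ε) :
    ∃ (N : ℕ) (ρ : 𝒜 →⋆ₐ[ℂ] (EuclideanSpace ℂ (Fin N) →L[ℂ] EuclideanSpace ℂ (Fin N)))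
      (ν : ℬ →⋆ₐ[ℂ] (EuclideanSpace ℂ (Fin N) →L[ℂ] EuclideanSpace ℂ (Fin N)))
      (T : H →L[ℂ] EuclideanSpace ℂ (Fin N)),
      (∀ a, π a = 0 → ρ a = 0) ∧ (∀ b, τ b = 0 → ν b = 0) ∧ (∀ x, ‖T x‖ ≤ ‖x‖) ∧
      (∀ x ∈ W, ‖T x‖ = ‖x‖) ∧
      (∀ a ∈ F, ∀ x ∈ W, π a x ∈ W →
        ‖T (π a x) - ρ a (T x)‖ ^ 2 ≤ ε * (2 * ‖π a x‖ * ‖x‖ + ‖x‖ * ‖x‖)) ∧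
      ∀ b ∈ G, ∀ x ∈ W, τ b x ∈ W →
        ‖T (τ b x) - ν b (T x)‖ ^ 2 ≤ ε * (2 * ‖τ b x‖ * ‖x‖ + ‖x‖ * ‖x‖) := by
  have hF' := hF.union (hF.image fun a => star a * a)
  have hG' := hG.union (hG.image fun b => star b * b)
  obtain ⟨R, hR, V, hV⟩ := exists_linearIsometry_norm_inner_sub_le hπ W hF'.toFinset hε
  obtain ⟨S, hS, U, hU⟩ := exists_linearIsometry_norm_inner_sub_le hτ W hG'.toFinset hε
  obtain ⟨N, V₀, ρ, ν, hρ, hν, hVρ, hUν⟩ := FinDimRep.exists_glue R S V U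
  let T : H →L[ℂ] EuclideanSpace ℂ (Fin N) :=
    V₀.toContinuousLinearMap.comp W.orthogonalProjectionOnto
  have hT : ∀ x (hx : x ∈ W), T x = V₀ ⟨x, hx⟩ := fun x hx =>
    congrArg V₀ (Submodule.orthogonalProjectionOnto_mem_subspace_eq_self (⟨x, hx⟩ : W))
  refine ⟨N, ρ, ν, T, fun a ha => hρ a (hR a ha), fun b hb => hν b (hS b hb), fun x => ?_,
    fun x hx => ?_, fun a ha x hx hy => ?_, fun b hb x hx hy => ?_⟩
  · change ‖V₀ (W.orthogonalProjectionOnto x)‖ ≤ _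
    rw [V₀.norm_map]
    exact W.norm_orthogonalProjectionOnto_apply_le x
  · rw [hT x hx, V₀.norm_map]
    rfl
  · rw [hT x hx, hT _ hy]
    refine norm_isometry_sub_sq_le V₀ (ρ a) (x := ⟨x, hx⟩) (y := ⟨π a x, hy⟩) ?_ ?_
    · rw [hVρ]
      exact hV a (by simp [ha]) _ _
    · rw [← map_star, ← map_mul, hVρ]
      have := hV (star a * a) (by simpa using Or.inr ⟨a, ha, rfl⟩) ⟨x, hx⟩ ⟨x, hx⟩
      rwa [map_mul π, map_star, mul_apply_eq_comp, ContinuousLinearMap.star_eq_adjoint,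
        ContinuousLinearMap.adjoint_inner_right] at this
  · rw [hT x hx, hT _ hy]
    refine norm_isometry_sub_sq_le V₀ (ν b) (x := ⟨x, hx⟩) (y := ⟨τ b x, hy⟩) ?_ ?_
    · rw [hUν]
      exact hU b (by simp [hb]) _ _
    · rw [← map_star, ← map_mul, hUν]
      have := hU (star b * b) (by simpa using Or.inr ⟨b, hb, rfl⟩) ⟨x, hx⟩ ⟨x, hx⟩
      rwa [map_mul τ, map_star, mul_apply_eq_comp, ContinuousLinearMap.star_eq_adjoint,
        ContinuousLinearMap.adjoint_inner_right] at this

end Stage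

section Amalgam

open Filter Topology

variable {A B C D : Type} [NonUnitalCStarAlgebra A] [NonUnitalCStarAlgebra B]
  [NonUnitalCStarAlgebra D] {H : Type} [NormedAddCommGroup H] [InnerProductSpace ℂ H]
  [CompleteSpace H]

theorem tendsto_norm_of_sq_le {ι : Type*} {l : Filter ι} {f ε : ι → ℝ} {M : ℝ}
    (hf : ∀ i, 0 ≤ f i) (hε : Tendsto ε l (𝓝 0)) (h : ∀ᶠ i in l, f i ^ 2 ≤ ε i * M) :
    Tendsto f l (𝓝 0) := by
  have h1 : Tendsto (fun i => f i ^ 2) l (𝓝 0) :=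
    squeeze_zero' (.of_forall fun i => sq_nonneg _) h (by simpa using hε.mul_const M)
  have h2 := (Real.continuous_sqrt.tendsto 0).comp h1
  rw [Real.sqrt_zero] at h2
  exact h2.congr fun i => Real.sqrt_sq (hf i)

theorem star_range_union_range_subset (iA : A →⋆ₙₐ[ℂ] D) (iB : B →⋆ₙₐ[ℂ] D) :
    star (Set.range iA ∪ Set.range iB) ⊆ Set.range iA ∪ Set.range iB := by
  rintro x (⟨a, ha⟩ | ⟨b, hb⟩)
  · exact Or.inl ⟨star a, by rw [map_star, ha, star_star]⟩
  · exact Or.inr ⟨star b, by rw [map_star, hb, star_star]⟩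

/-- Representations of a free product amalgamated over a common central subalgebra which are scalar
on that subalgebra are approximated by finite-dimensional ones. -/
theorem exists_finiteDimensional_apply_ne_zero (hA : IsStronglyRFD A) (hB : IsStronglyRFD B)
    {jA : C → A} {jB : C → B} {iA : A →⋆ₙₐ[ℂ] D} {iB : B →⋆ₙₐ[ℂ] D}
    (hagree : ∀ c, iA (jA c) = iB (jB c))
    (hgen : closure
      ((NonUnitalStarAlgebra.adjoin ℂ (Set.range iA ∪ Set.range iB) : Set D)) = Set.univ)
    (huniv : ∀ (N : ℕ)
      (ψA : A →⋆ₙₐ[ℂ] (EuclideanSpace ℂ (Fin N) →L[ℂ] EuclideanSpace ℂ (Fin N)))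
      (ψB : B →⋆ₙₐ[ℂ] (EuclideanSpace ℂ (Fin N) →L[ℂ] EuclideanSpace ℂ (Fin N))),
        (∀ c, ψA (jA c) = ψB (jB c)) →
        ∃ θ : D →⋆ₙₐ[ℂ] (EuclideanSpace ℂ (Fin N) →L[ℂ] EuclideanSpace ℂ (Fin N)),
          θ.comp iA = ψA ∧ θ.comp iB = ψB)
    (π : D →⋆ₙₐ[ℂ] (H →L[ℂ] H)) (hπ : ∀ c, ∃ z : ℂ, π (iA (jA c)) = z • 1) {d : D}
    (hd : π d ≠ 0) :
    ∃ (N : ℕ) (θ : D →⋆ₙₐ[ℂ] (EuclideanSpace ℂ (Fin N) →L[ℂ] EuclideanSpace ℂ (Fin N))),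
      θ d ≠ 0 := by
  obtain ⟨ξ, hξ⟩ : ∃ ξ, π d ξ ≠ 0 := by
    by_contra! h
    exact hd (ContinuousLinearMap.ext h)
  have hξ0 : ξ ≠ 0 := by
    rintro rfl
    exact hξ (map_zero _)
  have hπA := hA.isRFDImage_starLift (π.comp iA)
  have hπB := hB.isRFDImage_starLift (π.comp iB)
  have hliftA : ∀ a : A, Unitization.starLift (π.comp iA) (a : Unitization ℂ A) = π (iA a) :=
    fun a => by
      change algebraMap ℂ (H →L[ℂ] H) 0 + π (iA a) = _
      rw [map_zero, zero_add]
  have hliftB : ∀ b : B, Unitization.starLift (π.comp iB) (b : Unitization ℂ B) = π (iB b) :=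
    fun b => by
      change algebraMap ℂ (H →L[ℂ] H) 0 + π (iB b) = _
      rw [map_zero, zero_add]
  have stage : ∀ i : Finset H × Finset A × Finset B × ℕ, ∃ (N : ℕ)
      (θ : D →⋆ₙₐ[ℂ] (EuclideanSpace ℂ (Fin N) →L[ℂ] EuclideanSpace ℂ (Fin N)))
      (T : H →L[ℂ] EuclideanSpace ℂ (Fin N)),
      (∀ x, ‖T x‖ ≤ ‖x‖) ∧ (∀ x ∈ i.1, ‖T x‖ = ‖x‖) ∧
      (∀ a ∈ i.2.1, ∀ x ∈ i.1, π (iA a) x ∈ i.1 → ‖T (π (iA a) x) - θ (iA a) (T x)‖ ^ 2 ≤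
        1 / ((i.2.2.2 : ℝ) + 1) * (2 * ‖π (iA a) x‖ * ‖x‖ + ‖x‖ * ‖x‖)) ∧
      ∀ b ∈ i.2.2.1, ∀ x ∈ i.1, π (iB b) x ∈ i.1 → ‖T (π (iB b) x) - θ (iB b) (T x)‖ ^ 2 ≤
        1 / ((i.2.2.2 : ℝ) + 1) * (2 * ‖π (iB b) x‖ * ‖x‖ + ‖x‖ * ‖x‖) := by
    classical
    rintro ⟨X, F, G, n⟩
    let W : Submodule ℂ H := Submodule.span ℂ (insert ξ X : Finset H)
    have hX : ∀ x ∈ X, x ∈ W := fun x hx => Submodule.subset_span (by simp [hx])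
    have hW : Nontrivial W :=
      ⟨⟨ξ, Submodule.subset_span (by simp)⟩, 0, fun h => hξ0 (congrArg Subtype.val h)⟩
    obtain ⟨N, ρ, ν, T, hρ, hν, hT, hTW, hF, hG⟩ := exists_common_approximation hπA hπB W
      ((fun a : A => (a : Unitization ℂ A)) '' F) (F.finite_toSet.image _)
      ((fun b : B => (b : Unitization ℂ B)) '' G) (G.finite_toSet.image _)
      (Nat.one_div_pos_of_nat (n := n) (α := ℝ))
    obtain ⟨θ, hθA, hθB⟩ := huniv N
      ((ρ : Unitization ℂ A →⋆ₙₐ[ℂ] _).comp (Unitization.inrNonUnitalStarAlgHom ℂ A))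
      ((ν : Unitization ℂ B →⋆ₙₐ[ℂ] _).comp (Unitization.inrNonUnitalStarAlgHom ℂ B))
      fun c => by
        obtain ⟨z, hz⟩ := hπ c
        have h1 := hρ ((jA c : Unitization ℂ A) - z • 1) (by
          rw [map_sub, hliftA, hz, map_smul, map_one, sub_self])
        have h2 := hν ((jB c : Unitization ℂ B) - z • 1) (by
          rw [map_sub, hliftB, ← hagree, hz, map_smul, map_one, sub_self])
        rw [map_sub, map_smul, map_one, sub_eq_zero] at h1 h2
        exact h1.trans h2.symm
    have hθA' : ∀ a, θ (iA a) = ρ (a : Unitization ℂ A) := fun a => DFunLike.congr_fun hθA a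
    have hθB' : ∀ b, θ (iB b) = ν (b : Unitization ℂ B) := fun b => DFunLike.congr_fun hθB b
    refine ⟨N, θ, T, hT, fun x hx => hTW x (hX x hx), fun a ha x hx hy => ?_,
      fun b hb x hx hy => ?_⟩
    · have := hF a ⟨a, ha, rfl⟩ x (hX x hx)
      rw [hliftA] at this
      rw [hθA']
      exact this (hX _ hy)
    · have := hG b ⟨b, hb, rfl⟩ x (hX x hx)
      rw [hliftB] at this
      rw [hθB']
      exact this (hX _ hy)
  choose N θ T hT hTX hF hG using stage
  by_contra! hzero
  have hε : Tendsto (fun i : Finset H × Finset A × Finset B × ℕ => 1 / ((i.2.2.2 : ℝ) + 1)) atTop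
      (𝓝 0) := by
    refine tendsto_one_div_add_atTop_nhds_zero_nat.comp ?_
    refine tendsto_atTop.mpr fun n => ?_
    filter_upwards [eventually_ge_atTop (∅, ∅, ∅, n)] with i hi
    exact hi.2.2.2
  have hs := star_range_union_range_subset iA iB
  classical
  have key := tendsto_norm_intertwine_sub (l := atTop) (π := π) (θ := θ) (T := T) hT hs hgen (by
    rintro _ (⟨a, rfl⟩ | ⟨b, rfl⟩) x
    · refine tendsto_norm_of_sq_le (fun i => norm_nonneg _) hε
        (M := 2 * ‖π (iA a) x‖ * ‖x‖ + ‖x‖ * ‖x‖) ?_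
      filter_upwards [eventually_ge_atTop (({x, π (iA a) x} : Finset H), {a}, ∅, 0)] with i hi
      exact hF i a (hi.2.1 (by simp)) x (hi.1 (by simp)) (hi.1 (by simp))
    · refine tendsto_norm_of_sq_le (fun i => norm_nonneg _) hε
        (M := 2 * ‖π (iB b) x‖ * ‖x‖ + ‖x‖ * ‖x‖) ?_
      filter_upwards [eventually_ge_atTop (({x, π (iB b) x} : Finset H), ∅, {b}, 0)] with i hi
      exact hG i b (hi.2.2.1 (by simp)) x (hi.1 (by simp)) (hi.1 (by simp))) d ξ
  have hconst : Tendsto (fun _ : Finset H × Finset A × Finset B × ℕ => ‖π d ξ‖) atTop (𝓝 0) := by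
    refine key.congr' ?_
    filter_upwards [eventually_ge_atTop (({π d ξ} : Finset H), ∅, ∅, 0)] with i hi
    rw [hzero, zero_apply, sub_zero]
    exact hTX i _ (hi.1 (by simp))
  exact hξ (norm_eq_zero.mp (tendsto_nhds_unique tendsto_const_nhds hconst))

/-- An element commuting with a self-adjoint generating set is central in the unitization. -/
theorem Unitization.commute_inr_of_dense {s : Set D} (hs : star s ⊆ s)
    (hd : closure (NonUnitalStarAlgebra.adjoin ℂ s : Set D) = Set.univ) {z : D}
    (h : ∀ x ∈ s, z * x = x * z) (x : Unitization ℂ D) :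
    (z : Unitization ℂ D) * x = x * (z : Unitization ℂ D) := by
  have hz : ∀ x, z * x = x * z := by
    refine NonUnitalStarAlgebra.dense_adjoin_induction hs hd h (by simp)
      (fun x y hx hy => by rw [mul_add, add_mul, hx, hy])
      (fun x y hx hy => by rw [← mul_assoc, hx, mul_assoc, hy, mul_assoc])
      (fun c x hx => by rw [mul_smul_comm, smul_mul_assoc, hx])
      (isClosed_eq (by fun_prop) (by fun_prop))
  ext
  · simp
  · simp [hz]

end Amalgam

end Auxiliary

/-- **Courtney–Shulman.** Let `A` and `B` be separable strongly RFD C*-algebras and let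
`C` be a C*-subalgebra which is central in both `A` and `B` (given by injective
*-homomorphisms `jA, jB` with central images). If `D`, together with `iA : A → D` and
`iB : B → D` agreeing on `C`, generating `D` as a C*-algebra, and satisfying the
universal property, is the full amalgamated free product `A *_C B`, then `D` is RFD. -/
theorem stmt13
    (A : Type) [NonUnitalNormedRing A] [StarRing A] [CStarRing A] [CompleteSpace A]
    [NormedSpace ℂ A] [IsScalarTower ℂ A A] [SMulCommClass ℂ A A] [StarModule ℂ A]
    [TopologicalSpace.SeparableSpace A]
    (B : Type) [NonUnitalNormedRing B] [StarRing B] [CStarRing B] [CompleteSpace B]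
    [NormedSpace ℂ B] [IsScalarTower ℂ B B] [SMulCommClass ℂ B B] [StarModule ℂ B]
    [TopologicalSpace.SeparableSpace B]
    (C : Type) [NonUnitalNormedRing C] [StarRing C] [CStarRing C] [CompleteSpace C]
    [NormedSpace ℂ C] [IsScalarTower ℂ C C] [SMulCommClass ℂ C C] [StarModule ℂ C]
    (D : Type) [NonUnitalNormedRing D] [StarRing D] [CStarRing D] [CompleteSpace D]
    [NormedSpace ℂ D] [IsScalarTower ℂ D D] [SMulCommClass ℂ D D] [StarModule ℂ D]
    (hA : IsStronglyRFD A) (hB : IsStronglyRFD B)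
    (jA : C →⋆ₙₐ[ℂ] A) (jB : C →⋆ₙₐ[ℂ] B)
    (hjA : Function.Injective jA) (hjB : Function.Injective jB)
    (hcentA : ∀ c : C, ∀ a : A, jA c * a = a * jA c)
    (hcentB : ∀ c : C, ∀ b : B, jB c * b = b * jB c)
    (iA : A →⋆ₙₐ[ℂ] D) (iB : B →⋆ₙₐ[ℂ] D)
    (hagree : ∀ c : C, iA (jA c) = iB (jB c))
    (hgen : closure
      ((NonUnitalStarAlgebra.adjoin ℂ (Set.range iA ∪ Set.range iB) : Set D)) = Set.univ)
    (huniv : ∀ (E : Type) [NonUnitalNormedRing E] [StarRing E] [CStarRing E]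
      [CompleteSpace E] [NormedSpace ℂ E] [IsScalarTower ℂ E E] [SMulCommClass ℂ E E]
      [StarModule ℂ E],
      ∀ (ψA : A →⋆ₙₐ[ℂ] E) (ψB : B →⋆ₙₐ[ℂ] E),
        (∀ c : C, ψA (jA c) = ψB (jB c)) →
        ∃ θ : D →⋆ₙₐ[ℂ] E, θ.comp iA = ψA ∧ θ.comp iB = ψB) :
    IsRFD D := by
  let _ : NonUnitalCStarAlgebra A := {}
  let _ : NonUnitalCStarAlgebra B := {}
  let _ : NonUnitalCStarAlgebra D := {}
  intro d hd
  have hd' : (d : Unitization ℂ D) ≠ 0 := fun h => hd (Unitization.inr_injective h)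
  obtain ⟨H, _, _, _, π, hπd, hπ⟩ := exists_starAlgHom_center_scalar hd'
  have hs := star_range_union_range_subset iA iB
  refine exists_finiteDimensional_apply_ne_zero hA hB hagree hgen
    (fun N ψA ψB h => huniv _ ψA ψB h)
    ((π : Unitization ℂ D →⋆ₙₐ[ℂ] (H →L[ℂ] H)).comp (Unitization.inrNonUnitalStarAlgHom ℂ D))
    (fun c => hπ (iA (jA c) : D) (Unitization.commute_inr_of_dense hs hgen ?_)) hπd
  rintro _ (⟨a, rfl⟩ | ⟨b, rfl⟩)
  · rw [← map_mul, hcentA, map_mul]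
  · rw [hagree, ← map_mul, hcentB, map_mul]
end
end

section
/- Let A and B be separable RFD C*-algebras. Then the full (unital or non-unital) free product A * B is residually finite dimensional. -/
noncomputable section

open scoped ComplexOrder InnerProductSpace

/-- The Gelfand–Naimark theorem, pointwise form: a nonzero element of a unital C*-algebra acts
nontrivially in some GNS representation. -/
theorem exists_starAlgHom_ne_zero {U : Type} [CStarAlgebra U] {d : U} (hd : d ≠ 0) :
    ∃ (H : Type) (_ : NormedAddCommGroup H) (_ : InnerProductSpace ℂ H) (_ : CompleteSpace H)
      (π : U →⋆ₐ[ℂ] (H →L[ℂ] H)), π d ≠ 0 := by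
  let _ := CStarAlgebra.spectralOrder U
  have _ := CStarAlgebra.spectralOrderedRing U
  have hneg : -(star d * d) ∉ {a : U | 0 ≤ a} := by
    intro h
    have h0 : star d * d = 0 :=
      le_antisymm (neg_nonneg.mp h) (star_mul_self_nonneg d)
    exact hd ((CStarRing.star_mul_self_eq_zero_iff d).mp h0)
  have hconv : Convex ℝ {a : U | 0 ≤ a} := by
    intro x (hx : 0 ≤ x) y (hy : 0 ≤ y) s t hs ht _
    show (0 : U) ≤ s • x + t • y
    exact add_nonneg (smul_nonneg hs hx) (smul_nonneg ht hy)
  obtain ⟨f, u, hfd, hf⟩ := RCLike.geometric_hahn_banach_point_closed (𝕜 := ℂ) hconv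
    CStarAlgebra.isClosed_nonneg hneg
  have hu : u < 0 := by simpa using hf 0 (show (0 : U) ≤ 0 from le_rfl)
  have hpos : ∀ a : U, 0 ≤ a → 0 ≤ (f a).re := by
    intro a ha
    by_contra! hlt
    have h1 := hf (((u / (f a).re : ℝ) : ℂ) • a) (by
      have h2 : 0 ≤ (u / (f a).re) := (div_pos_of_neg_of_neg hu hlt).le
      show (0 : U) ≤ _ • a
      rw [Complex.coe_smul]
      exact smul_nonneg h2 ha)
    simp only [map_smul, smul_eq_mul] at h1
    rw [RCLike.re_eq_complex_re, Complex.re_ofReal_mul, div_mul_cancel₀ _ hlt.ne] at h1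
    exact lt_irrefl _ h1
  let g₀ : U →ₗ[ℂ] ℂ :=
    { toFun := fun a => (f a + starRingEnd ℂ (f (star a))) / 2
      map_add' := by intro a b; simp only [map_add, star_add]; ring
      map_smul' := by
        intro c a
        simp only [map_smul, star_smul, smul_eq_mul, map_mul, RCLike.star_def, RingHom.id_apply,
          Complex.conj_conj]
        ring }
  have hg₀ : ∀ a : U, IsSelfAdjoint a → g₀ a = ((f a).re : ℂ) := by
    intro a ha
    change (f a + starRingEnd ℂ (f (star a))) / 2 = _
    rw [ha.star_eq, Complex.add_conj]
    push_cast
    ring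
  let g : U →ₚ[ℂ] ℂ := PositiveLinearMap.mk₀ g₀ (by
    intro a ha
    rw [hg₀ a (IsSelfAdjoint.of_nonneg ha)]
    exact_mod_cast hpos a ha)
  refine ⟨g.GNS, inferInstance, inferInstance, inferInstance, g.gnsStarAlgHom, ?_⟩
  intro h0
  have h1 : g.gnsStarAlgHom d (g.toPreGNS 1 : g.PreGNS) = 0 := by rw [h0]; rfl
  have h2 : g.leftMulMapPreGNS d (g.toPreGNS 1) = g.toPreGNS d := by simp
  have h3 : g.gnsStarAlgHom d (g.toPreGNS 1 : g.PreGNS) = (g.toPreGNS d : g.PreGNS) := by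
    rw [← h2]
    exact g.gnsNonUnitalStarAlgHom_apply_coe
  rw [h1] at h3
  have h4 : ‖g.toPreGNS d‖ = 0 := by
    rw [← UniformSpace.Completion.norm_coe, ← h3, norm_zero]
  have h5 := g.preGNS_norm_sq (g.toPreGNS d)
  rw [h4, PositiveLinearMap.ofPreGNS_toPreGNS] at h5
  have h6 : g (star d * d) = ((f (star d * d)).re : ℂ) := hg₀ _ (IsSelfAdjoint.star_mul_self d)
  rw [h6] at h5
  have h7 : (f (star d * d)).re = 0 := by
    have := congrArg Complex.re h5
    simpa using this.symm
  simp only [map_neg, RCLike.re_eq_complex_re, h7] at hfd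
  linarith

section HilbertSumInclusions

variable {K L : Type} [NormedAddCommGroup K] [InnerProductSpace ℂ K]
  [NormedAddCommGroup L] [InnerProductSpace ℂ L]

/-- The isometric inclusion of the first summand of a Hilbert sum. -/
def inlIsometry (K L : Type) [NormedAddCommGroup K] [InnerProductSpace ℂ K]
    [NormedAddCommGroup L] [InnerProductSpace ℂ L] : K →ₗᵢ[ℂ] WithLp 2 (K × L) where
  toFun x := WithLp.toLp 2 (x, 0)
  map_add' x y := by apply WithLp.ofLp_injective; simp
  map_smul' c x := by apply WithLp.ofLp_injective; simp
  norm_map' x := by simp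

/-- The isometric inclusion of the second summand of a Hilbert sum. -/
def inrIsometry (K L : Type) [NormedAddCommGroup K] [InnerProductSpace ℂ K]
    [NormedAddCommGroup L] [InnerProductSpace ℂ L] : L →ₗᵢ[ℂ] WithLp 2 (K × L) where
  toFun x := WithLp.toLp 2 (0, x)
  map_add' x y := by apply WithLp.ofLp_injective; simp
  map_smul' c x := by apply WithLp.ofLp_injective; simp
  norm_map' x := by simp

theorem inner_inlIsometry_inrIsometry (x : K) (y : L) :
    ⟪inlIsometry K L x, inrIsometry K L y⟫_ℂ = 0 := by
  simp [inlIsometry, inrIsometry, WithLp.prod_inner_apply]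

theorem inner_inrIsometry_inlIsometry (x : K) (y : L) :
    ⟪inrIsometry K L y, inlIsometry K L x⟫_ℂ = 0 := by
  simp [inlIsometry, inrIsometry, WithLp.prod_inner_apply]

theorem inner_add_inlIsometry_inrIsometry (x x' : K) (y y' : L) :
    ⟪inlIsometry K L x + inrIsometry K L y, inlIsometry K L x' + inrIsometry K L y'⟫_ℂ =
      ⟪x, x'⟫_ℂ + ⟪y, y'⟫_ℂ := by
  simp [inlIsometry, inrIsometry, WithLp.prod_inner_apply]

end HilbertSumInclusions

section CornerRepresentations

variable {A : Type} [NonUnitalCStarAlgebra A]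
  {K L : Type} [NormedAddCommGroup K] [InnerProductSpace ℂ K] [CompleteSpace K]
  [NormedAddCommGroup L] [InnerProductSpace ℂ L] [CompleteSpace L]

/-- Transport of a representation on `K` to the range of an isometry `S : K → L`, acting by zero
on the orthogonal complement of this range. -/
def cornerRep (S : K →ₗᵢ[ℂ] L) (ρ : A →⋆ₙₐ[ℂ] (K →L[ℂ] K)) : A →⋆ₙₐ[ℂ] (L →L[ℂ] L) where
  toFun a := S.toContinuousLinearMap ∘L ρ a ∘L S.toContinuousLinearMap.adjoint
  map_smul' c a := by ext; simp
  map_zero' := by ext; simp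
  map_add' a b := by ext; simp
  map_mul' a b := by
    ext x
    simp only [map_mul, ContinuousLinearMap.comp_apply, mul_apply_eq_comp]
    congr 2
    exact (DFunLike.congr_fun S.adjoint_comp_self _).symm
  map_star' a := by
    simp only [map_star, ContinuousLinearMap.star_eq_adjoint, ContinuousLinearMap.adjoint_comp,
      ContinuousLinearMap.adjoint_adjoint, ContinuousLinearMap.comp_assoc]

theorem cornerRep_apply_apply (S : K →ₗᵢ[ℂ] L) (ρ : A →⋆ₙₐ[ℂ] (K →L[ℂ] K)) (a : A) (x : K) :
    cornerRep S ρ a (S x) = S (ρ a x) := by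
  change S (ρ a (S.toContinuousLinearMap.adjoint (S.toContinuousLinearMap x))) = _
  congr 2
  exact DFunLike.congr_fun S.adjoint_comp_self x

theorem cornerRep_apply_eq_zero (S : K →ₗᵢ[ℂ] L) (ρ : A →⋆ₙₐ[ℂ] (K →L[ℂ] K)) (a : A) {y : L}
    (hy : ∀ x, ⟪S x, y⟫_ℂ = 0) : cornerRep S ρ a y = 0 := by
  have : S.toContinuousLinearMap.adjoint y = 0 := by
    refine ext_inner_left ℂ fun x => ?_
    rw [ContinuousLinearMap.adjoint_inner_right, inner_zero_right]
    exact hy x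
  change S (ρ a (S.toContinuousLinearMap.adjoint y)) = 0
  rw [this, map_zero, map_zero]

/-- The sum of two mutually orthogonal representations. -/
def addRep (σ τ : A →⋆ₙₐ[ℂ] (L →L[ℂ] L)) (h : ∀ a b, σ a * τ b = 0) :
    A →⋆ₙₐ[ℂ] (L →L[ℂ] L) where
  toFun a := σ a + τ a
  map_smul' c a := by simp
  map_zero' := by simp
  map_add' a b := by simp only [map_add]; abel
  map_mul' a b := by
    have h' : τ a * σ b = 0 := by
      have := congrArg star (h (star b) (star a))
      simpa [← map_star] using this
    simp [add_mul, mul_add, h, h']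
  map_star' a := by simp [map_star]

/-- The direct sum of two representations. -/
def directSumRep (ρ : A →⋆ₙₐ[ℂ] (K →L[ℂ] K)) (σ : A →⋆ₙₐ[ℂ] (L →L[ℂ] L)) :
    A →⋆ₙₐ[ℂ] (WithLp 2 (K × L) →L[ℂ] WithLp 2 (K × L)) :=
  addRep (cornerRep (inlIsometry K L) ρ) (cornerRep (inrIsometry K L) σ) (by
    intro a b
    ext x : 1
    exact cornerRep_apply_eq_zero (inlIsometry K L) ρ a fun y =>
      inner_inlIsometry_inrIsometry y _)

theorem directSumRep_apply (ρ : A →⋆ₙₐ[ℂ] (K →L[ℂ] K)) (σ : A →⋆ₙₐ[ℂ] (L →L[ℂ] L)) (a : A)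
    (x : K) (y : L) :
    directSumRep ρ σ a (inlIsometry K L x + inrIsometry K L y) =
      inlIsometry K L (ρ a x) + inrIsometry K L (σ a y) := by
  change cornerRep (inlIsometry K L) ρ a _ + cornerRep (inrIsometry K L) σ a _ = _
  rw [map_add, map_add, cornerRep_apply_apply, cornerRep_apply_apply,
    cornerRep_apply_eq_zero _ _ _ fun z => inner_inlIsometry_inrIsometry z y,
    cornerRep_apply_eq_zero _ _ _ fun z => inner_inrIsometry_inlIsometry x z, add_zero, zero_add]

end CornerRepresentations

section MatrixPositivity

variable {n : Type} [Fintype n]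
  {U : Type} [CStarAlgebra U]
  {K : Type} [NormedAddCommGroup K] [InnerProductSpace ℂ K] [CompleteSpace K]

/-- The action of a matrix over `U` on tuples of vectors of a representation of `U`. -/
def matAct (φ : U →⋆ₐ[ℂ] (K →L[ℂ] K)) (h : CStarMatrix n n U) (η : n → K) : n → K :=
  fun i => ∑ j, φ (h i j) (η j)

/-- The sesquilinear form of a matrix over `U` on tuples of vectors of a representation of `U`. -/
def matForm (φ : U →⋆ₐ[ℂ] (K →L[ℂ] K)) (h : CStarMatrix n n U) (η ζ : n → K) : ℂ :=
  ∑ i, ⟪ζ i, matAct φ h η i⟫_ℂ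

theorem matAct_mul (φ : U →⋆ₐ[ℂ] (K →L[ℂ] K)) (g h : CStarMatrix n n U) (η : n → K) :
    matAct φ (g * h) η = matAct φ g (matAct φ h η) := by
  ext i
  simp only [matAct, CStarMatrix.mul_apply, map_sum, map_mul, _root_.sum_apply,
    mul_apply_eq_comp]
  rw [Finset.sum_comm]

theorem matForm_star_mul (φ : U →⋆ₐ[ℂ] (K →L[ℂ] K)) (g h : CStarMatrix n n U) (η ζ : n → K) :
    matForm φ (star g * h) η ζ = matForm φ h η (matAct φ g ζ) := by
  unfold matForm
  rw [matAct_mul]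
  generalize matAct φ h η = ξ
  simp only [matAct, inner_sum, sum_inner, CStarMatrix.star_apply, map_star,
    ContinuousLinearMap.star_eq_adjoint, ContinuousLinearMap.adjoint_inner_right]
  rw [Finset.sum_comm]

theorem matForm_star_mul_self (φ : U →⋆ₐ[ℂ] (K →L[ℂ] K)) (g : CStarMatrix n n U) (η : n → K) :
    (matForm φ (star g * g) η η).re = ∑ i, ‖matAct φ g η i‖ ^ 2 := by
  rw [matForm_star_mul]
  simp only [matForm, Complex.re_sum]
  exact Finset.sum_congr rfl fun i _ => (norm_sq_eq_re_inner (𝕜 := ℂ) _).symm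

theorem matForm_neg (φ : U →⋆ₐ[ℂ] (K →L[ℂ] K)) (h : CStarMatrix n n U) (η ζ : n → K) :
    matForm φ (-h) η ζ = -matForm φ h η ζ := by
  simp only [matForm, matAct, CStarMatrix.neg_apply, map_neg, _root_.neg_apply,
    Finset.sum_neg_distrib, inner_neg_right]

theorem apply_eq_zero_of_matAct_eq_zero (φ : U →⋆ₐ[ℂ] (K →L[ℂ] K)) (g : CStarMatrix n n U)
    (hg : ∀ η : n → K, matAct φ g η = 0) (i j : n) : φ (g i j) = 0 := by
  classical
  ext x
  have := congrFun (hg (Pi.single j x)) i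
  rw [matAct, Finset.sum_eq_single j] at this
  · simpa using this
  · intro k _ hk
    rw [Pi.single_eq_of_ne hk, map_zero]
  · simp

end MatrixPositivity

/-- A selfadjoint element of a C*-algebra is `t² - s²` with selfadjoint `s`, `t`, `s t = 0`. -/
theorem IsSelfAdjoint.exists_eq_sq_sub_sq {M : Type} [NonUnitalCStarAlgebra M] {h : M}
    (hh : IsSelfAdjoint h) :
    ∃ s t : M, IsSelfAdjoint s ∧ IsSelfAdjoint t ∧ s * t = 0 ∧ h = t * t - s * s := by
  refine ⟨cfcₙ (fun x : ℝ => √(x⁻)) h, cfcₙ (fun x : ℝ => √(x⁺)) h, ?_, ?_, ?_, ?_⟩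
  · exact cfcₙ_predicate _ _
  · exact cfcₙ_predicate _ _
  · rw [← cfcₙ_mul _ _ h]
    rw [← cfcₙ_zero ℝ h]
    congr 1
    ext x
    rcases le_total 0 x with hx | hx
    · simp [negPart_eq_zero.mpr hx]
    · simp [posPart_eq_zero.mpr hx]
  · rw [← cfcₙ_mul _ _ h, ← cfcₙ_mul _ _ h, ← cfcₙ_sub _ _ h]
    conv_lhs => rw [← cfcₙ_id ℝ h]
    congr 1
    ext x
    simp [Real.mul_self_sqrt, posPart_nonneg, negPart_nonneg, posPart_sub_negPart]

section FiniteDimensionalApproximation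

variable {A : Type} [NonUnitalCStarAlgebra A]
  {H : Type} [NormedAddCommGroup H] [InnerProductSpace ℂ H] [CompleteSpace H]

theorem starLift_apply_vector (π : A →⋆ₙₐ[ℂ] (H →L[ℂ] H)) (u : Unitization ℂ A) (x : H) :
    Unitization.starLift π u x = u.fst • x + π u.snd x := by
  change (algebraMap ℂ (H →L[ℂ] H) u.fst + π u.snd) x = _
  rw [Algebra.algebraMap_eq_smul_one]
  simp

theorem IsRFD.eq_zero_of_starLift_eq_zero (hA : IsRFD A) {u : Unitization ℂ A}
    (hu : ∀ (N : ℕ)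
      (ρ : A →⋆ₙₐ[ℂ] (EuclideanSpace ℂ (Fin N) →L[ℂ] EuclideanSpace ℂ (Fin N))),
      Unitization.starLift ρ u = 0) : u = 0 := by
  have hfst : u.fst = 0 := by
    have h := DFunLike.congr_fun (hu 1 0) (EuclideanSpace.single 0 1)
    rw [starLift_apply_vector] at h
    simpa using h
  ext
  · exact hfst
  · by_contra hne
    obtain ⟨N, ρ, hρ⟩ := hA u.snd hne
    refine hρ ?_
    ext x : 1
    have h := DFunLike.congr_fun (hu N ρ) x
    rw [starLift_apply_vector, hfst, zero_smul, zero_add] at h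
    exact h

theorem matForm_add {n : Type} [Fintype n] {U : Type} [CStarAlgebra U]
    (φ : U →⋆ₐ[ℂ] (H →L[ℂ] H)) (g h : CStarMatrix n n U) (η ζ : n → H) :
    matForm φ (g + h) η ζ = matForm φ g η ζ + matForm φ h η ζ := by
  simp only [matForm, matAct, CStarMatrix.add_apply, map_add, _root_.add_apply,
    Finset.sum_add_distrib, inner_add_right]

theorem matForm_star {n : Type} [Fintype n] {U : Type} [CStarAlgebra U]
    (φ : U →⋆ₐ[ℂ] (H →L[ℂ] H)) (h : CStarMatrix n n U) (η ζ : n → H) :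
    matForm φ (star h) η ζ = starRingEnd ℂ (matForm φ h ζ η) := by
  simp only [matForm, matAct, inner_sum, map_sum, CStarMatrix.star_apply, map_star,
    ContinuousLinearMap.star_eq_adjoint, ContinuousLinearMap.adjoint_inner_right, inner_conj_symm]
  rw [Finset.sum_comm]

/-- Positivity of matrices over an RFD algebra can be tested on finite-dimensional
representations. -/
theorem IsRFD.re_matForm_nonneg (hA : IsRFD A) {n : Type} [Fintype n]
    (h : CStarMatrix n n (Unitization ℂ A))
    (hpos : ∀ (N : ℕ)
      (ρ : A →⋆ₙₐ[ℂ] (EuclideanSpace ℂ (Fin N) →L[ℂ] EuclideanSpace ℂ (Fin N)))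
      (η : n → EuclideanSpace ℂ (Fin N)), 0 ≤ (matForm (Unitization.starLift ρ) h η η).re)
    (π : A →⋆ₙₐ[ℂ] (H →L[ℂ] H)) (e : n → H) :
    0 ≤ (matForm (Unitization.starLift π) h e e).re := by
  let _ := CStarAlgebra.spectralOrder (Unitization ℂ A)
  have _ := CStarAlgebra.spectralOrderedRing (Unitization ℂ A)
  obtain ⟨s, t, hs, ht, hst, hdec⟩ :=
    (IsSelfAdjoint.add_star_self h).exists_eq_sq_sub_sq
  have hs2 : IsSelfAdjoint (s * s) := by
    simpa [hs.star_eq] using IsSelfAdjoint.star_mul_self s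
  have hconj : star s * ((h + star h) * s) = -(star (s * s) * (s * s)) := by
    rw [hdec, hs2.star_eq, hs.star_eq, sub_mul, mul_sub, ← mul_assoc s (t * t) s,
      ← mul_assoc s t t, hst]
    simp [mul_assoc]
  have hss : s * s = 0 := by
    refine CStarMatrix.ext fun i j => ?_
    refine hA.eq_zero_of_starLift_eq_zero fun N ρ =>
      apply_eq_zero_of_matAct_eq_zero _ _ (fun η => ?_) i j
    have h1 := matForm_star_mul (Unitization.starLift ρ) s ((h + star h) * s) η η
    rw [hconj, matForm_neg] at h1
    have h2 : matForm (Unitization.starLift ρ) ((h + star h) * s) η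
        (matAct (Unitization.starLift ρ) s η) = matForm (Unitization.starLift ρ) (h + star h)
          (matAct (Unitization.starLift ρ) s η) (matAct (Unitization.starLift ρ) s η) := by
      simp only [matForm, matAct_mul]
    rw [h2, matForm_add, matForm_star] at h1
    have h3 := congrArg Complex.re h1
    rw [Complex.neg_re, matForm_star_mul_self, Complex.add_re, Complex.conj_re] at h3
    have h4 := hpos N ρ (matAct (Unitization.starLift ρ) s η)
    have h5 : ∑ i, ‖matAct (Unitization.starLift ρ) (s * s) η i‖ ^ 2 = 0 :=
      le_antisymm (by linarith) (Finset.sum_nonneg fun i _ => by positivity)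
    rw [Finset.sum_eq_zero_iff_of_nonneg fun i _ => by positivity] at h5
    ext1 i
    simpa using h5 i (Finset.mem_univ i)
  have h6 : 0 ≤ (matForm (Unitization.starLift π) (h + star h) e e).re := by
    have h7 : t * t = star t * t := by rw [ht.star_eq]
    rw [hdec, hss, sub_zero, h7, matForm_star_mul_self]
    positivity
  rw [matForm_add, matForm_star, Complex.add_re, Complex.conj_re] at h6
  linarith

/-- The set of arrays of matrix coefficients of finite-dimensional representations. -/
def fdCoefficients {n ι : Type} (u : ι → Unitization ℂ A) : Set (ι × n × n → ℂ) :=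
  {z | ∃ (N : ℕ) (ρ : A →⋆ₙₐ[ℂ] (EuclideanSpace ℂ (Fin N) →L[ℂ] EuclideanSpace ℂ (Fin N)))
    (η : n → EuclideanSpace ℂ (Fin N)),
    ∀ q, z q = ⟪η q.2.1, Unitization.starLift ρ (u q.1) (η q.2.2)⟫_ℂ}

theorem mem_fdCoefficients {n ι : Type} {u : ι → Unitization ℂ A}
    {K : Type} [NormedAddCommGroup K] [InnerProductSpace ℂ K] [CompleteSpace K]
    [FiniteDimensional ℂ K] (ρ : A →⋆ₙₐ[ℂ] (K →L[ℂ] K)) (η : n → K) :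
    (fun q : ι × n × n => ⟪η q.2.1, Unitization.starLift ρ (u q.1) (η q.2.2)⟫_ℂ) ∈
      fdCoefficients u := by
  let S : K →ₗᵢ[ℂ] EuclideanSpace ℂ (Fin (Module.finrank ℂ K)) :=
    (stdOrthonormalBasis ℂ K).repr.toLinearIsometry
  refine ⟨_, cornerRep S ρ, fun i => S (η i), fun q => ?_⟩
  simp only [starLift_apply_vector, cornerRep_apply_apply, ← map_smul, ← map_add,
    S.inner_map_map]

theorem smul_add_smul_mem_fdCoefficients {n ι : Type} {u : ι → Unitization ℂ A}
    {x y : ι × n × n → ℂ} (hx : x ∈ fdCoefficients u) (hy : y ∈ fdCoefficients u) {s t : ℝ}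
    (hs : 0 ≤ s) (ht : 0 ≤ t) : s • x + t • y ∈ fdCoefficients u := by
  obtain ⟨N, ρ, η, hx⟩ := hx
  obtain ⟨M, σ, ζ, hy⟩ := hy
  have hmem := mem_fdCoefficients (u := u) (directSumRep ρ σ)
    (fun i => inlIsometry _ _ ((√s : ℂ) • η i) + inrIsometry _ _ ((√t : ℂ) • ζ i))
  convert hmem using 1
  ext q
  have hs' : (√s : ℂ) * √s = s := by exact_mod_cast Real.mul_self_sqrt hs
  have ht' : (√t : ℂ) * √t = t := by exact_mod_cast Real.mul_self_sqrt ht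
  have hadd : ∀ (c : ℂ) (a b c' d' : WithLp 2 (EuclideanSpace ℂ (Fin N) ×
      EuclideanSpace ℂ (Fin M))), c • (a + b) + (c' + d') = (c • a + c') + (c • b + d') := by
    intros; rw [smul_add]; abel
  simp only [starLift_apply_vector, directSumRep_apply]
  rw [hadd, ← map_smul, ← map_smul, ← map_add, ← map_add, inner_add_inlIsometry_inrIsometry,
    Pi.add_apply, Pi.smul_apply, Pi.smul_apply, hx, hy, starLift_apply_vector,
    starLift_apply_vector, map_smul, map_smul, smul_comm _ (√s : ℂ), smul_comm _ (√t : ℂ),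
    ← smul_add, ← smul_add, inner_smul_left, inner_smul_right, inner_smul_left, inner_smul_right,
    Complex.conj_ofReal, Complex.conj_ofReal, ← mul_assoc, ← mul_assoc, hs', ht',
    Complex.real_smul, Complex.real_smul]

/-- Matrix coefficients of an arbitrary representation of an RFD algebra are limits of matrix
coefficients of finite-dimensional representations. -/
theorem IsRFD.mem_closure_fdCoefficients (hA : IsRFD A) {n ι : Type} [Fintype n] [Fintype ι]
    (u : ι → Unitization ℂ A) (π : A →⋆ₙₐ[ℂ] (H →L[ℂ] H)) (e : n → H) :
    (fun q : ι × n × n => ⟪e q.2.1, Unitization.starLift π (u q.1) (e q.2.2)⟫_ℂ) ∈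
      closure (fdCoefficients u) := by
  classical
  by_contra hne
  have hconv : Convex ℝ (fdCoefficients (n := n) u) := fun x hx y hy s t hs ht _ =>
    smul_add_smul_mem_fdCoefficients hx hy hs ht
  obtain ⟨f, r, hfr, hf⟩ := RCLike.geometric_hahn_banach_point_closed (𝕜 := ℂ) hconv.closure
    isClosed_closure hne
  have hzero : (0 : ι × n × n → ℂ) ∈ fdCoefficients u :=
    ⟨0, 0, 0, fun q => by simp⟩
  have hr : r < 0 := by simpa using hf 0 (subset_closure hzero)
  have hnonneg : ∀ z ∈ fdCoefficients u, 0 ≤ (f z).re := by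
    intro z hz
    by_contra! hlt
    have h1 := hf _ (subset_closure (smul_add_smul_mem_fdCoefficients hz hzero
      (div_pos_of_neg_of_neg hr hlt).le le_rfl))
    rw [smul_zero, add_zero, ← Complex.coe_smul, map_smul, smul_eq_mul, RCLike.re_eq_complex_re,
      Complex.re_ofReal_mul, div_mul_cancel₀ _ hlt.ne] at h1
    exact lt_irrefl _ h1
  let h : CStarMatrix n n (Unitization ℂ A) :=
    CStarMatrix.ofMatrix fun i j => ∑ p, f (Pi.single (p, i, j) 1) • u p
  have key : ∀ {K : Type} [NormedAddCommGroup K] [InnerProductSpace ℂ K] [CompleteSpace K]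
      (ρ : A →⋆ₙₐ[ℂ] (K →L[ℂ] K)) (η : n → K), matForm (Unitization.starLift ρ) h η η =
        f (fun q : ι × n × n => ⟪η q.2.1, Unitization.starLift ρ (u q.1) (η q.2.2)⟫_ℂ) := by
    intro K _ _ _ ρ η
    have h1 := LinearMap.pi_apply_eq_sum_univ (f : (ι × n × n → ℂ) →ₗ[ℂ] ℂ)
      (fun q : ι × n × n => ⟪η q.2.1, Unitization.starLift ρ (u q.1) (η q.2.2)⟫_ℂ)
    rw [ContinuousLinearMap.coe_coe] at h1
    rw [h1, Fintype.sum_prod_type, Finset.sum_comm, Fintype.sum_prod_type]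
    simp only [matForm, matAct, inner_sum]
    refine Finset.sum_congr rfl fun i _ => Finset.sum_congr rfl fun j _ => ?_
    have h2 : h i j = ∑ p, f (Pi.single (p, i, j) 1) • u p := rfl
    rw [h2, map_sum, _root_.sum_apply, inner_sum]
    refine Finset.sum_congr rfl fun p _ => ?_
    have h3 : (fun q : ι × n × n => if (p, i, j) = q then (1 : ℂ) else 0) =
        Pi.single (p, i, j) 1 := by
      ext q
      simp [Pi.single_apply, eq_comm]
    rw [map_smul, _root_.smul_apply, inner_smul_right, h3,
      smul_eq_mul, mul_comm]
  have h4 := hA.re_matForm_nonneg h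
    (fun N ρ η => by rw [key]; exact hnonneg _ (mem_fdCoefficients ρ η)) π e
  rw [key] at h4
  rw [RCLike.re_eq_complex_re] at hfr
  linarith

end FiniteDimensionalApproximation

section AsymptoticIntertwiners

variable {A : Type} [NonUnitalCStarAlgebra A]
  {H : Type} [NormedAddCommGroup H] [InnerProductSpace ℂ H] [CompleteSpace H]

theorem norm_inner_apply_le_of_orthonormalBasis {V n : Type} [NormedAddCommGroup V]
    [InnerProductSpace ℂ V] [Fintype n] (b : OrthonormalBasis n ℂ V) (M : V →ₗ[ℂ] V) {δ : ℝ}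
    (hM : ∀ i j, ‖⟪b i, M (b j)⟫_ℂ‖ ≤ δ) (x y : V) :
    ‖⟪y, M x⟫_ℂ‖ ≤ (Fintype.card n) ^ 2 * δ * ‖x‖ * ‖y‖ := by
  have hb : ∀ (i : n) (z : V), ‖⟪b i, z⟫_ℂ‖ ≤ ‖z‖ := fun i z => by
    simpa using norm_inner_le_norm (𝕜 := ℂ) (b i) z
  have hexp : ⟪y, M x⟫_ℂ = ∑ i, ∑ j, ⟪y, b i⟫_ℂ * (⟪b j, x⟫_ℂ * ⟪b i, M (b j)⟫_ℂ) := by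
    conv_lhs => rw [← b.sum_repr' x]
    rw [← b.sum_inner_mul_inner]
    simp only [map_sum, map_smul, inner_sum, inner_smul_right, Finset.mul_sum]
  rw [hexp]
  calc ‖∑ i, ∑ j, ⟪y, b i⟫_ℂ * (⟪b j, x⟫_ℂ * ⟪b i, M (b j)⟫_ℂ)‖
      ≤ ∑ _i : n, ∑ _j : n, ‖y‖ * (‖x‖ * δ) := by
        refine norm_sum_le_of_le _ fun i _ => norm_sum_le_of_le _ fun j _ => ?_
        rw [norm_mul, norm_mul, norm_inner_symm]
        exact mul_le_mul (hb i y) (mul_le_mul (hb j x) (hM i j) (norm_nonneg _) (norm_nonneg _))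
          (by positivity) (norm_nonneg _)
    _ = _ := by
        simp only [Finset.sum_const, Finset.card_univ, nsmul_eq_mul]
        ring

/-- Finitely many matrix coefficients of a representation over a finite-dimensional subspace are
approximated by a finite-dimensional representation, with the subspace embedded almost
isometrically. -/
theorem IsRFD.exists_approx_coefficients (hA : IsRFD A) (π : A →⋆ₙₐ[ℂ] (H →L[ℂ] H))
    (V : Submodule ℂ H) [FiniteDimensional ℂ V] (F : Finset A) {ε : ℝ} (hε : 0 < ε) :
    ∃ (N : ℕ) (ρ : A →⋆ₙₐ[ℂ] (EuclideanSpace ℂ (Fin N) →L[ℂ] EuclideanSpace ℂ (Fin N)))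
      (T : V →L[ℂ] EuclideanSpace ℂ (Fin N)),
      (∀ x y : V, ‖⟪T y, T x⟫_ℂ - ⟪y, x⟫_ℂ‖ ≤ ε * ‖x‖ * ‖y‖) ∧
      ∀ a ∈ F, ∀ x y : V, ‖⟪T y, ρ a (T x)⟫_ℂ - ⟪(y : H), π a x⟫_ℂ‖ ≤ ε * ‖x‖ * ‖y‖ := by
  let b := stdOrthonormalBasis ℂ V
  let u : Option F → Unitization ℂ A := fun p => p.elim 1 fun a => (a : A)
  let d : ℝ := (Fintype.card (Fin (Module.finrank ℂ V))) ^ 2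
  have hd : 0 ≤ d := by positivity
  obtain ⟨z, ⟨N, ρ, η, hz⟩, hdist⟩ := Metric.mem_closure_iff.mp
    (hA.mem_closure_fdCoefficients u π (fun i => (b i : H))) (ε / (d + 1)) (by positivity)
  let T : V →L[ℂ] EuclideanSpace ℂ (Fin N) :=
    LinearMap.toContinuousLinearMap (b.toBasis.constr ℂ η)
  have hT : ∀ i, T (b i) = η i := fun i => by
    simp [T]
  have hdε : d * (ε / (d + 1)) ≤ ε := by
    rw [mul_div_assoc', div_le_iff₀ (by positivity)]
    nlinarith
  have key : ∀ (p : Option F) (x y : V), ‖⟪T y, Unitization.starLift ρ (u p) (T x)⟫_ℂ -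
      ⟪(y : H), Unitization.starLift π (u p) x⟫_ℂ‖ ≤ ε * ‖x‖ * ‖y‖ := by
    intro p x y
    let M : V →L[ℂ] V := T.adjoint ∘L Unitization.starLift ρ (u p) ∘L T -
      V.subtypeL.adjoint ∘L Unitization.starLift π (u p) ∘L V.subtypeL
    have hM : ∀ x y : V, ⟪y, M x⟫_ℂ = ⟪T y, Unitization.starLift ρ (u p) (T x)⟫_ℂ -
        ⟪(y : H), Unitization.starLift π (u p) x⟫_ℂ := by
      intro x y
      simp only [M, _root_.sub_apply, inner_sub_right, ContinuousLinearMap.comp_apply,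
        ContinuousLinearMap.adjoint_inner_right, Submodule.subtypeL_apply]
    have hbd := norm_inner_apply_le_of_orthonormalBasis b (M : V →ₗ[ℂ] V)
      (δ := ε / (d + 1)) (fun i j => by
        rw [ContinuousLinearMap.coe_coe, hM, hT, hT, ← hz (p, i, j), ← dist_eq_norm, dist_comm]
        exact ((dist_le_pi_dist _ _ (p, i, j)).trans_lt hdist).le) x y
    rw [ContinuousLinearMap.coe_coe, hM] at hbd
    refine hbd.trans ?_
    gcongr
  refine ⟨N, ρ, T, fun x y => ?_, fun a ha x y => ?_⟩
  · simpa [u] using key none x y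
  · have h := key (some ⟨a, ha⟩) x y
    simpa only [starLift_apply_vector, u, Option.elim_some, Unitization.fst_inr,
      Unitization.snd_inr, zero_smul, zero_add] using h

/-- An almost isometric operator, after rescaling, is the first component of an isometry. -/
theorem exists_isometry_dilation {V K : Type} [NormedAddCommGroup V] [InnerProductSpace ℂ V]
    [CompleteSpace V] [NormedAddCommGroup K] [InnerProductSpace ℂ K] [CompleteSpace K]
    (T : V →L[ℂ] K) {ε : ℝ} (hε : 0 < ε)
    (hT : ∀ x y : V, ‖⟪T y, T x⟫_ℂ - ⟪y, x⟫_ℂ‖ ≤ ε * ‖x‖ * ‖y‖) :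
    ∃ (c : ℝ) (S : V →L[ℂ] V) (T' : V →ₗᵢ[ℂ] WithLp 2 (K × V)),
      (c : ℂ) * c = ((1 + ε : ℝ) : ℂ)⁻¹ ∧
      ∀ x, T' x = (c : ℂ) • (inlIsometry K V (T x) + inrIsometry K V (S x)) := by
  let R : V →L[ℂ] V := ((1 + ε : ℝ) : ℂ) • 1 - T.adjoint ∘L T
  have hR : ∀ x y : V, ⟪y, R x⟫_ℂ = ((1 + ε : ℝ) : ℂ) * ⟪y, x⟫_ℂ - ⟪T y, T x⟫_ℂ := by
    intro x y
    simp only [R, _root_.sub_apply, _root_.smul_apply, one_apply_eq_self,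
      inner_sub_right, inner_smul_right, ContinuousLinearMap.comp_apply,
      ContinuousLinearMap.adjoint_inner_right]
  have hRpos : 0 ≤ R := by
    rw [ContinuousLinearMap.nonneg_iff_isPositive, ContinuousLinearMap.isPositive_iff_complex]
    intro x
    have him : ⟪x, R x⟫_ℂ = (((1 + ε) * ‖x‖ ^ 2 - ‖T x‖ ^ 2 : ℝ) : ℂ) := by
      rw [hR, inner_self_eq_norm_sq_to_K, inner_self_eq_norm_sq_to_K]
      push_cast
      rfl
    have hle : ‖T x‖ ^ 2 - ‖x‖ ^ 2 ≤ ε * ‖x‖ * ‖x‖ := by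
      refine le_trans (le_trans (le_abs_self _) ?_) (hT x x)
      rw [inner_self_eq_norm_sq_to_K, inner_self_eq_norm_sq_to_K]
      norm_cast
    rw [← inner_conj_symm, him, Complex.conj_ofReal]
    refine ⟨rfl, ?_⟩
    simp only [RCLike.re_eq_complex_re, Complex.ofReal_re]
    nlinarith
  obtain ⟨S, hS⟩ := CStarAlgebra.nonneg_iff_eq_star_mul_self.mp hRpos
  have hSR : ∀ x y : V, ⟪S y, S x⟫_ℂ = ⟪y, R x⟫_ℂ := by
    intro x y
    rw [hS, mul_apply_eq_comp, ContinuousLinearMap.star_eq_adjoint,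
      ContinuousLinearMap.adjoint_inner_right]
  let c : ℝ := (√(1 + ε))⁻¹
  have hc : (c : ℂ) * c = ((1 + ε : ℝ) : ℂ)⁻¹ := by
    have : c * c = (1 + ε)⁻¹ := by
      rw [← mul_inv, Real.mul_self_sqrt (by positivity)]
    exact_mod_cast this
  have hne : ((1 + ε : ℝ) : ℂ) ≠ 0 := by
    exact_mod_cast (by positivity : (1 + ε : ℝ) ≠ 0)
  let T' : V →ₗ[ℂ] WithLp 2 (K × V) :=
    (c : ℂ) • ((inlIsometry K V).toLinearMap ∘ₗ (T : V →ₗ[ℂ] K) +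
      (inrIsometry K V).toLinearMap ∘ₗ (S : V →ₗ[ℂ] V))
  have hT' : ∀ x, T' x = (c : ℂ) • (inlIsometry K V (T x) + inrIsometry K V (S x)) :=
    fun _ => rfl
  have hiso : ∀ x y, ⟪T' x, T' y⟫_ℂ = ⟪x, y⟫_ℂ := by
    intro x y
    rw [hT', hT', inner_smul_left, inner_smul_right, inner_add_inlIsometry_inrIsometry,
      Complex.conj_ofReal, ← mul_assoc, hc, hSR, hR, add_sub_cancel, inv_mul_cancel_left₀ hne]
  exact ⟨c, S, T'.isometryOfInner hiso, hc, hT'⟩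

/-- As `IsRFD.exists_approx_coefficients`, with an exactly isometric embedding. -/
theorem IsRFD.exists_isometry_approx_coefficients (hA : IsRFD A) (π : A →⋆ₙₐ[ℂ] (H →L[ℂ] H))
    (V : Submodule ℂ H) [FiniteDimensional ℂ V] (F : Finset A) {ε : ℝ} (hε : 0 < ε) :
    ∃ (K : Type) (_ : NormedAddCommGroup K) (_ : InnerProductSpace ℂ K) (_ : CompleteSpace K)
      (_ : FiniteDimensional ℂ K) (ρ : A →⋆ₙₐ[ℂ] (K →L[ℂ] K)) (T : V →ₗᵢ[ℂ] K),
      ∀ a ∈ F, ∀ x y : V,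
        ‖⟪T y, ρ a (T x)⟫_ℂ - ⟪(y : H), π a x⟫_ℂ‖ ≤ ε * (1 + ‖π a‖) * ‖x‖ * ‖y‖ := by
  obtain ⟨N, ρ, T, hT, hρ⟩ := hA.exists_approx_coefficients π V F hε
  obtain ⟨c, S, T', hc, hT'⟩ := exists_isometry_dilation T hε hT
  have hne : ((1 + ε : ℝ) : ℂ) ≠ 0 := by
    exact_mod_cast (by positivity : (1 + ε : ℝ) ≠ 0)
  let J := inlIsometry (EuclideanSpace ℂ (Fin N)) V
  refine ⟨WithLp 2 (EuclideanSpace ℂ (Fin N) × V), inferInstance, inferInstance, inferInstance,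
    inferInstance, cornerRep J ρ, T', fun a ha x y => ?_⟩
  have hcoef : ⟪T' y, cornerRep J ρ a (T' x)⟫_ℂ =
      ((1 + ε : ℝ) : ℂ)⁻¹ * ⟪T y, ρ a (T x)⟫_ℂ := by
    rw [hT', hT', map_smul, map_add, cornerRep_apply_apply,
      cornerRep_apply_eq_zero _ _ _ fun z => inner_inlIsometry_inrIsometry z _, add_zero,
      inner_smul_left, inner_smul_right, inner_add_left, inner_inrIsometry_inlIsometry, add_zero,
      LinearIsometry.inner_map_map, Complex.conj_ofReal, ← mul_assoc, hc]
  have hsplit : ⟪T' y, cornerRep J ρ a (T' x)⟫_ℂ -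
      ⟪(y : H), π a x⟫_ℂ = ((1 + ε : ℝ) : ℂ)⁻¹ *
        ((⟪T y, ρ a (T x)⟫_ℂ - ⟪(y : H), π a x⟫_ℂ) - (ε : ℂ) * ⟪(y : H), π a x⟫_ℂ) := by
    rw [hcoef, eq_inv_mul_iff_mul_eq₀ hne, mul_sub, mul_inv_cancel_left₀ hne]
    push_cast
    ring
  have hπ : ‖⟪(y : H), π a x⟫_ℂ‖ ≤ ‖π a‖ * ‖x‖ * ‖y‖ := by
    refine (norm_inner_le_norm _ _).trans ?_
    rw [mul_comm]
    exact mul_le_mul_of_nonneg_right ((π a).le_opNorm x) (norm_nonneg _)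
  rw [hsplit, norm_mul, norm_inv, Complex.norm_real, Real.norm_of_nonneg (by positivity)]
  refine (mul_le_of_le_one_left (norm_nonneg _) (inv_le_one_of_one_le₀ (by linarith))).trans ?_
  refine (norm_sub_le _ _).trans ?_
  rw [norm_mul, Complex.norm_real, Real.norm_of_nonneg hε.le]
  calc _ ≤ ε * ‖x‖ * ‖y‖ + ε * (‖π a‖ * ‖x‖ * ‖y‖) :=
        add_le_add (hρ a ha x y) (mul_le_mul_of_nonneg_left hπ hε.le)
    _ = _ := by ring

/-- A representation of an RFD algebra is asymptotically intertwined with finite-dimensional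
representations through isometric embeddings of finite-dimensional subspaces. -/
theorem IsRFD.exists_isometry_approx_intertwining (hA : IsRFD A) (π : A →⋆ₙₐ[ℂ] (H →L[ℂ] H))
    (V : Submodule ℂ H) [FiniteDimensional ℂ V] (F : Finset A) {ε : ℝ} (hε : 0 < ε) :
    ∃ (K : Type) (_ : NormedAddCommGroup K) (_ : InnerProductSpace ℂ K) (_ : CompleteSpace K)
      (_ : FiniteDimensional ℂ K) (ρ : A →⋆ₙₐ[ℂ] (K →L[ℂ] K)) (T : V →ₗᵢ[ℂ] K),
      ∀ a ∈ F, ∀ x y : V, π a x = y →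
        ‖ρ a (T x) - T y‖ ^ 2 ≤
          ε * ((1 + ‖π (star a * a)‖) * ‖x‖ ^ 2 + 2 * ((1 + ‖π a‖) * ‖x‖ * ‖y‖)) := by
  classical
  obtain ⟨K, i₁, i₂, i₃, i₄, ρ, T, hT⟩ :=
    hA.exists_isometry_approx_coefficients π V (F ∪ F.image fun a => star a * a) hε
  refine ⟨K, i₁, i₂, i₃, i₄, ρ, T, fun a ha x y hxy => ?_⟩
  have h1 := hT (star a * a)
    (Finset.mem_union_right _ (Finset.mem_image_of_mem _ ha)) x x
  have h2 := hT a (Finset.mem_union_left _ ha) x y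
  have hstar : ∀ {L : Type} [NormedAddCommGroup L] [InnerProductSpace ℂ L] [CompleteSpace L]
      (σ : A →⋆ₙₐ[ℂ] (L →L[ℂ] L)) (v : L), ⟪v, σ (star a * a) v⟫_ℂ = ((‖σ a v‖ ^ 2 : ℝ) : ℂ) := by
    intro L _ _ _ σ v
    rw [map_mul, map_star, mul_apply_eq_comp, ContinuousLinearMap.star_eq_adjoint,
      ContinuousLinearMap.adjoint_inner_right, inner_self_eq_norm_sq_to_K]
    push_cast
    rfl
  rw [hstar, hstar, hxy, ← Complex.ofReal_sub, Complex.norm_real] at h1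
  have h3 : ⟪(y : H), π a x⟫_ℂ = ((‖y‖ ^ 2 : ℝ) : ℂ) := by
    rw [hxy, inner_self_eq_norm_sq_to_K]
    push_cast
    rfl
  rw [h3] at h2
  have h4 := (le_abs_self _).trans h1
  have h5 := (Complex.abs_re_le_norm _).trans h2
  rw [Complex.sub_re, Complex.ofReal_re] at h5
  have h6 := neg_le_of_abs_le h5
  have h7 := norm_sub_sq (𝕜 := ℂ) (T y) (ρ a (T x))
  rw [norm_sub_rev, h7, T.norm_map, RCLike.re_eq_complex_re]
  have hy : ‖(y : H)‖ = ‖y‖ := rfl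
  rw [hy] at h4
  linarith

end AsymptoticIntertwiners

section PairOfRepresentations

variable {A B : Type} [NonUnitalCStarAlgebra A] [NonUnitalCStarAlgebra B]

/-- Two isometries into finite-dimensional spaces can be made to agree by enlarging their
codomains to a common Euclidean space. -/
theorem exists_isometries_comp_eq {V K L : Type} [NormedAddCommGroup V] [InnerProductSpace ℂ V]
    [NormedAddCommGroup K] [InnerProductSpace ℂ K] [FiniteDimensional ℂ K]
    [NormedAddCommGroup L] [InnerProductSpace ℂ L] [FiniteDimensional ℂ L]
    (S : V →ₗᵢ[ℂ] K) (T : V →ₗᵢ[ℂ] L) :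
    ∃ (N : ℕ) (P : K →ₗᵢ[ℂ] EuclideanSpace ℂ (Fin N)) (Q : L →ₗᵢ[ℂ] EuclideanSpace ℂ (Fin N)),
      P.comp S = Q.comp T := by
  let r := (stdOrthonormalBasis ℂ (WithLp 2 (K × L))).repr.toLinearIsometry
  let T₁ := (inrIsometry K L).comp T
  let e := T₁.equivRange
  let X := (((inlIsometry K L).comp S).comp e.symm.toLinearIsometry).extend
  refine ⟨_, r.comp (inlIsometry K L), r.comp (X.comp (inrIsometry K L)), ?_⟩
  ext1 v
  have h := (((inlIsometry K L).comp S).comp e.symm.toLinearIsometry).extend_apply (e v)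
  have h' : X (inrIsometry K L (T v)) = inlIsometry K L (S v) := by
    refine h.trans ?_
    simp
  exact congrArg r h'.symm

theorem exists_isometry_approx_intertwining_pair (hA : IsRFD A) (hB : IsRFD B)
    {H : Type} [NormedAddCommGroup H] [InnerProductSpace ℂ H] [CompleteSpace H]
    (πA : A →⋆ₙₐ[ℂ] (H →L[ℂ] H)) (πB : B →⋆ₙₐ[ℂ] (H →L[ℂ] H))
    (V : Submodule ℂ H) [FiniteDimensional ℂ V] (F : Finset A) (G : Finset B)
    {ε : ℝ} (hε : 0 < ε) :
    ∃ (N : ℕ) (σA : A →⋆ₙₐ[ℂ] (EuclideanSpace ℂ (Fin N) →L[ℂ] EuclideanSpace ℂ (Fin N)))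
      (σB : B →⋆ₙₐ[ℂ] (EuclideanSpace ℂ (Fin N) →L[ℂ] EuclideanSpace ℂ (Fin N)))
      (T : V →ₗᵢ[ℂ] EuclideanSpace ℂ (Fin N)),
      (∀ a ∈ F, ∀ x y : V, πA a x = y →
        ‖σA a (T x) - T y‖ ^ 2 ≤
          ε * ((1 + ‖πA (star a * a)‖) * ‖x‖ ^ 2 + 2 * ((1 + ‖πA a‖) * ‖x‖ * ‖y‖))) ∧
      ∀ b ∈ G, ∀ x y : V, πB b x = y →
        ‖σB b (T x) - T y‖ ^ 2 ≤
          ε * ((1 + ‖πB (star b * b)‖) * ‖x‖ ^ 2 + 2 * ((1 + ‖πB b‖) * ‖x‖ * ‖y‖)) := by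
  obtain ⟨K, _, _, _, _, ρ, S, hS⟩ := hA.exists_isometry_approx_intertwining πA V F hε
  obtain ⟨L, _, _, _, _, τ, T, hT⟩ := hB.exists_isometry_approx_intertwining πB V G hε
  obtain ⟨N, P, Q, hPQ⟩ := exists_isometries_comp_eq S T
  have hPQ' : ∀ v, P (S v) = Q (T v) := fun v => DFunLike.congr_fun hPQ v
  refine ⟨N, cornerRep P ρ, cornerRep Q τ, P.comp S, fun a ha x y hxy => ?_,
    fun b hb x y hxy => ?_⟩
  · change ‖cornerRep P ρ a (P (S x)) - P (S y)‖ ^ 2 ≤ _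
    rw [cornerRep_apply_apply, ← map_sub, P.norm_map]
    exact hS a ha x y hxy
  · change ‖cornerRep Q τ b (P (S x)) - P (S y)‖ ^ 2 ≤ _
    rw [hPQ', hPQ', cornerRep_apply_apply, ← map_sub, Q.norm_map]
    exact hT b hb x y hxy

end PairOfRepresentations

section AsymptoticDilation

open Filter Topology

variable {D : Type} [NonUnitalCStarAlgebra D]
  {H : Type} [NormedAddCommGroup H] [InnerProductSpace ℂ H] [CompleteSpace H]

/-- The elements on which a family of representations is asymptotically intertwined with a fixed
representation. -/
def AsympIntertwined {I : Type} (l : Filter I) (π : D →⋆ₙₐ[ℂ] (H →L[ℂ] H)) {K : I → Type}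
    [∀ i, NormedAddCommGroup (K i)] [∀ i, InnerProductSpace ℂ (K i)] [∀ i, CompleteSpace (K i)]
    (θ : ∀ i, D →⋆ₙₐ[ℂ] (K i →L[ℂ] K i)) (T : ∀ i, H →L[ℂ] K i) (d : D) : Prop :=
  ∀ x, Tendsto (fun i => ‖θ i d (T i x) - T i (π d x)‖) l (𝓝 0)

namespace AsympIntertwined

variable {I : Type} {l : Filter I} {π : D →⋆ₙₐ[ℂ] (H →L[ℂ] H)} {K : I → Type}
    [∀ i, NormedAddCommGroup (K i)] [∀ i, InnerProductSpace ℂ (K i)] [∀ i, CompleteSpace (K i)]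
    {θ : ∀ i, D →⋆ₙₐ[ℂ] (K i →L[ℂ] K i)} {T : ∀ i, H →L[ℂ] K i} {d e : D}

theorem zero : AsympIntertwined l π θ T 0 := fun x => by
  simpa using tendsto_const_nhds

theorem add (hd : AsympIntertwined l π θ T d) (he : AsympIntertwined l π θ T e) :
    AsympIntertwined l π θ T (d + e) := fun x => by
  refine squeeze_zero (fun _ => norm_nonneg _) (fun i => ?_) (by simpa using (hd x).add (he x))
  refine le_trans (le_of_eq ?_) (norm_add_le _ _)
  simp only [map_add, _root_.add_apply]
  congr 1
  abel

theorem smul (hd : AsympIntertwined l π θ T d) (c : ℂ) :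
    AsympIntertwined l π θ T (c • d) := fun x => by
  simpa only [map_smul, _root_.smul_apply, ← smul_sub, norm_smul, mul_zero] using
    (hd x).const_mul ‖c‖

theorem norm_apply_apply_le {L : Type} [NormedAddCommGroup L] [InnerProductSpace ℂ L]
    [CompleteSpace L] (σ : D →⋆ₙₐ[ℂ] (L →L[ℂ] L)) (d : D) (x : L) : ‖σ d x‖ ≤ ‖d‖ * ‖x‖ :=
  ((σ d).le_opNorm x).trans
    (mul_le_mul_of_nonneg_right (NonUnitalStarAlgHom.norm_apply_le σ d) (norm_nonneg _))

theorem mul (hd : AsympIntertwined l π θ T d) (he : AsympIntertwined l π θ T e) :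
    AsympIntertwined l π θ T (d * e) := fun x => by
  refine squeeze_zero (fun _ => norm_nonneg _) (fun i => ?_)
    (by simpa using ((he x).const_mul ‖d‖).add (hd (π e x)))
  have heq : θ i (d * e) (T i x) - T i (π (d * e) x) =
      θ i d (θ i e (T i x) - T i (π e x)) + (θ i d (T i (π e x)) - T i (π d (π e x))) := by
    simp only [map_mul, mul_apply_eq_comp, map_sub]
    abel
  rw [heq]
  exact (norm_add_le _ _).trans (add_le_add_left (norm_apply_apply_le _ _ _) _)

theorem of_mem_closure (hT : ∀ i x, ‖T i x‖ ≤ ‖x‖) {s : Set D}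
    (hs : ∀ d ∈ s, AsympIntertwined l π θ T d) (hd : d ∈ closure s) :
    AsympIntertwined l π θ T d := fun x => by
  rw [Metric.tendsto_nhds]
  intro ε hε
  obtain ⟨e, hes, hde⟩ := Metric.mem_closure_iff.mp hd (ε / (2 * (‖x‖ + 1) + 1)) (by positivity)
  rw [dist_eq_norm, lt_div_iff₀ (by positivity)] at hde
  have h := (Metric.tendsto_nhds.mp (hs e hes x)) (‖d - e‖ + (ε - ‖d - e‖ *
    (2 * (‖x‖ + 1) + 1))) (by nlinarith [norm_nonneg (d - e)])
  filter_upwards [h] with i hi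
  rw [dist_zero_right, norm_norm] at hi ⊢
  have heq : θ i d (T i x) - T i (π d x) =
      θ i (d - e) (T i x) - T i (π (d - e) x) + (θ i e (T i x) - T i (π e x)) := by
    simp only [map_sub, _root_.sub_apply]
    abel
  have h1 : ‖θ i (d - e) (T i x)‖ ≤ ‖d - e‖ * ‖x‖ :=
    (norm_apply_apply_le _ _ _).trans (mul_le_mul_of_nonneg_left (hT i x) (norm_nonneg _))
  have h2 : ‖T i (π (d - e) x)‖ ≤ ‖d - e‖ * ‖x‖ :=
    (hT i _).trans (norm_apply_apply_le _ _ _)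
  rw [heq]
  have h3 := norm_add_le (θ i (d - e) (T i x) - T i (π (d - e) x)) (θ i e (T i x) - T i (π e x))
  have h4 := norm_sub_le (θ i (d - e) (T i x)) (T i (π (d - e) x))
  nlinarith [norm_nonneg (d - e)]

theorem of_mem_adjoin {s : Set D} (hs : ∀ d ∈ s, AsympIntertwined l π θ T d)
    (hstar : ∀ d ∈ s, star d ∈ s) (hd : d ∈ NonUnitalStarAlgebra.adjoin ℂ s) :
    AsympIntertwined l π θ T d := by
  have hss : s ∪ star s = s :=
    Set.union_eq_self_of_subset_right fun d hd => by simpa using hstar _ hd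
  have hd' : d ∈ (NonUnitalStarAlgebra.adjoin ℂ s).toNonUnitalSubalgebra := hd
  rw [NonUnitalStarAlgebra.adjoin_toNonUnitalSubalgebra, hss] at hd'
  clear hd
  induction hd' using NonUnitalAlgebra.adjoin_induction with
  | mem x hx => exact hs x hx
  | add x y _ _ hx hy => exact hx.add hy
  | zero => exact zero
  | mul x y _ _ hx hy => exact hx.mul hy
  | smul c x _ hx => exact hx.smul c

end AsympIntertwined

end AsymptoticDilation

section FreeProduct

open Filter Topology

variable {A B D : Type} [NonUnitalCStarAlgebra A] [NonUnitalCStarAlgebra B]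
  [NonUnitalCStarAlgebra D]

theorem exists_nonUnitalStarAlgHom_ne_zero {d : D} (hd : d ≠ 0) :
    ∃ (H : Type) (_ : NormedAddCommGroup H) (_ : InnerProductSpace ℂ H) (_ : CompleteSpace H)
      (π : D →⋆ₙₐ[ℂ] (H →L[ℂ] H)), π d ≠ 0 := by
  obtain ⟨H, i₁, i₂, i₃, π, hπ⟩ := exists_starAlgHom_ne_zero
    (d := (d : Unitization ℂ D))
    (by rwa [Ne, ← Unitization.inr_zero ℂ, Unitization.inr_injective.eq_iff])
  exact ⟨H, i₁, i₂, i₃, (π : Unitization ℂ D →⋆ₙₐ[ℂ] (H →L[ℂ] H)).comp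
    (Unitization.inrNonUnitalStarAlgHom ℂ D), hπ⟩

theorem tendsto_zero_of_sq_le_mul {I : Type} {l : Filter I}
    (f : I → ℝ) (r : ℝ) (ε : I → ℝ) (hε : Tendsto ε l (𝓝 0)) (hf : ∀ i, 0 ≤ f i)
    (h : ∀ᶠ i in l, f i ^ 2 ≤ ε i * r) : Tendsto f l (𝓝 0) := by
  have h2 : Tendsto (fun i => f i ^ 2) l (𝓝 0) :=
    squeeze_zero' (Eventually.of_forall fun i => sq_nonneg _) h (by simpa using hε.mul_const r)
  have := h2.sqrt
  simpa [Real.sqrt_sq, hf] using this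

theorem IsRFD.of_freeProduct (hA : IsRFD A) (hB : IsRFD B)
    (iA : A →⋆ₙₐ[ℂ] D) (iB : B →⋆ₙₐ[ℂ] D)
    (hgen : closure
      ((NonUnitalStarAlgebra.adjoin ℂ (Set.range iA ∪ Set.range iB) : Set D)) = Set.univ)
    (huniv : ∀ (N : ℕ)
      (ψA : A →⋆ₙₐ[ℂ] (EuclideanSpace ℂ (Fin N) →L[ℂ] EuclideanSpace ℂ (Fin N)))
      (ψB : B →⋆ₙₐ[ℂ] (EuclideanSpace ℂ (Fin N) →L[ℂ] EuclideanSpace ℂ (Fin N))),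
        ∃ θ : D →⋆ₙₐ[ℂ] (EuclideanSpace ℂ (Fin N) →L[ℂ] EuclideanSpace ℂ (Fin N)),
          θ.comp iA = ψA ∧ θ.comp iB = ψB) :
    IsRFD D := by
  classical
  intro d hd
  by_contra! hzero
  obtain ⟨H, _, _, _, π, hπ⟩ := exists_nonUnitalStarAlgHom_ne_zero hd
  obtain ⟨ξ, hξ⟩ : ∃ ξ, π d ξ ≠ 0 := by
    by_contra! h
    exact hπ (ContinuousLinearMap.ext h)
  let I := (Finset H × Finset A) × (Finset B × ℕ)
  let V : I → Submodule ℂ H := fun i => Submodule.span ℂ (i.1.1 : Set H)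
  have hV : ∀ i, FiniteDimensional ℂ (V i) := fun i =>
    FiniteDimensional.span_finset ℂ i.1.1
  let ε : I → ℝ := fun i => 1 / ((i.2.2 : ℝ) + 1)
  have hε : ∀ i, 0 < ε i := fun i => by positivity
  choose N σA σB S hSA hSB using fun i => exists_isometry_approx_intertwining_pair hA hB
    (π.comp iA) (π.comp iB) (V i) i.1.2 i.2.1 (hε i)
  choose θ hθA hθB using fun i => huniv (N i) (σA i) (σB i)
  let T : ∀ i, H →L[ℂ] EuclideanSpace ℂ (Fin (N i)) := fun i =>
    (S i).toContinuousLinearMap ∘L (V i).orthogonalProjectionOnto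
  have hTV : ∀ i (x : V i), T i x = S i x := fun i x =>
    congrArg (S i) (Submodule.orthogonalProjectionOnto_mem_subspace_eq_self x)
  have hT : ∀ i x, ‖T i x‖ ≤ ‖x‖ := fun i x => by
    refine ((S i).norm_map _).le.trans ?_
    exact Submodule.norm_orthogonalProjectionOnto_apply_le _ _
  have hVmem : ∀ x : H, ∀ᶠ i : I in atTop, x ∈ V i := fun x => by
    filter_upwards [eventually_ge_atTop ((({x}, ∅), (∅, 0)) : I)] with i hi
    exact Submodule.subset_span (hi.1.1 (Finset.mem_singleton_self x))
  have hεlim : Tendsto ε atTop (𝓝 0) := by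
    refine tendsto_one_div_add_atTop_nhds_zero_nat.comp ?_
    refine tendsto_atTop.mpr fun k => ?_
    filter_upwards [eventually_ge_atTop (((∅, ∅), (∅, k)) : I)] with i hi using hi.2.2
  have hPA : ∀ a, AsympIntertwined atTop π θ T (iA a) := fun a x => by
    refine tendsto_zero_of_sq_le_mul _ ((1 + ‖π (iA (star a * a))‖) * ‖x‖ ^ 2 +
      2 * ((1 + ‖π (iA a)‖) * ‖x‖ * ‖π (iA a) x‖)) ε hεlim (fun i => norm_nonneg _) ?_
    filter_upwards [hVmem x, hVmem (π (iA a) x),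
      eventually_ge_atTop (((∅, {a}), (∅, 0)) : I)] with i hx hy hi
    have h := hSA i a (hi.1.2 (Finset.mem_singleton_self a)) ⟨x, hx⟩ ⟨_, hy⟩ rfl
    rw [← hTV, ← hTV, ← hθA] at h
    exact h
  have hPB : ∀ b, AsympIntertwined atTop π θ T (iB b) := fun b x => by
    refine tendsto_zero_of_sq_le_mul _ ((1 + ‖π (iB (star b * b))‖) * ‖x‖ ^ 2 +
      2 * ((1 + ‖π (iB b)‖) * ‖x‖ * ‖π (iB b) x‖)) ε hεlim (fun i => norm_nonneg _) ?_
    filter_upwards [hVmem x, hVmem (π (iB b) x),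
      eventually_ge_atTop (((∅, ∅), ({b}, 0)) : I)] with i hx hy hi
    have h := hSB i b (hi.2.1 (Finset.mem_singleton_self b)) ⟨x, hx⟩ ⟨_, hy⟩ rfl
    rw [← hTV, ← hTV, ← hθB] at h
    exact h
  have hP : AsympIntertwined atTop π θ T d := by
    refine AsympIntertwined.of_mem_closure hT
      (s := (NonUnitalStarAlgebra.adjoin ℂ (Set.range iA ∪ Set.range iB) : Set D))
      (fun e he => AsympIntertwined.of_mem_adjoin ?_ ?_ he) (hgen ▸ Set.mem_univ d)
    · rintro _ (⟨a, rfl⟩ | ⟨b, rfl⟩)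
      exacts [hPA a, hPB b]
    · rintro _ (⟨a, rfl⟩ | ⟨b, rfl⟩)
      exacts [Or.inl ⟨star a, map_star iA a⟩, Or.inr ⟨star b, map_star iB b⟩]
  have hconst : Tendsto (fun _ : I => ‖π d ξ‖) atTop (𝓝 0) := by
    refine (hP ξ).congr' ?_
    filter_upwards [hVmem (π d ξ)] with i hi
    rw [hzero, _root_.zero_apply, zero_sub, norm_neg, hTV i ⟨_, hi⟩, (S i).norm_map]
    rfl
  exact hξ (norm_eq_zero.mp (tendsto_nhds_unique tendsto_const_nhds hconst))

end FreeProduct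

/-- **Exel–Loring.** Let `A` and `B` be separable RFD C*-algebras. If `D`, together with
`iA : A → D` and `iB : B → D` generating `D` as a C*-algebra and satisfying the
universal property (every pair of representations of `A` and `B` into a common
C*-algebra factors through `D`), is the full free product `A * B`, then `D` is RFD. -/
theorem stmt14
    (A : Type) [NonUnitalNormedRing A] [StarRing A] [CStarRing A] [CompleteSpace A]
    [NormedSpace ℂ A] [IsScalarTower ℂ A A] [SMulCommClass ℂ A A] [StarModule ℂ A]
    [TopologicalSpace.SeparableSpace A]
    (B : Type) [NonUnitalNormedRing B] [StarRing B] [CStarRing B] [CompleteSpace B]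
    [NormedSpace ℂ B] [IsScalarTower ℂ B B] [SMulCommClass ℂ B B] [StarModule ℂ B]
    [TopologicalSpace.SeparableSpace B]
    (D : Type) [NonUnitalNormedRing D] [StarRing D] [CStarRing D] [CompleteSpace D]
    [NormedSpace ℂ D] [IsScalarTower ℂ D D] [SMulCommClass ℂ D D] [StarModule ℂ D]
    (hA : IsRFD A) (hB : IsRFD B)
    (iA : A →⋆ₙₐ[ℂ] D) (iB : B →⋆ₙₐ[ℂ] D)
    (hgen : closure
      ((NonUnitalStarAlgebra.adjoin ℂ (Set.range iA ∪ Set.range iB) : Set D)) = Set.univ)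
    (huniv : ∀ (E : Type) [NonUnitalNormedRing E] [StarRing E] [CStarRing E]
      [CompleteSpace E] [NormedSpace ℂ E] [IsScalarTower ℂ E E] [SMulCommClass ℂ E E]
      [StarModule ℂ E],
      ∀ (ψA : A →⋆ₙₐ[ℂ] E) (ψB : B →⋆ₙₐ[ℂ] E),
        ∃ θ : D →⋆ₙₐ[ℂ] E, θ.comp iA = ψA ∧ θ.comp iB = ψB) :
    IsRFD D := by
  let _ : NonUnitalCStarAlgebra A := {}
  let _ : NonUnitalCStarAlgebra B := {}
  let _ : NonUnitalCStarAlgebra D := {}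
  exact IsRFD.of_freeProduct hA hB iA iB hgen fun _ ψA ψB => huniv _ ψA ψB
end
end
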